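/- arXiv:2104.10160 — 5 statements merged into one kernel-verified Lean document; each statement's English description precedes it below -/
import Mathlib

section
/- Assume R is right semihereditary, the class of s-torsion left R-modules is nontrivial, and M is an s-torsion left R-module. Then the following are equivalent: (1) M is Σ-K^{s-Tor}-pure-injective; (2) the countable direct sum M^{(ℵ₀)} is K^{s-Tor}-pure-injective; (3) M has the low-pp descending chain condition. -/
/- Core notions: pp-formulas, low formulas, s-torsion modules, pure embeddings. -/

universe u

open Cardinal

/-- A positive primitive (pp) formula in `n` free variables over the ring `R`:
an existentially quantified finite system of linear equations.  It is given by the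
number of existentially quantified variables, the number of equations, and the
matrices of coefficients of the free and of the existentially quantified variables. -/
structure PPFormula (R : Type u) [Ring R] (n : ℕ) : Type u where
  nExist : ℕ
  nEq : ℕ
  coeffFree : Fin nEq → Fin n → R
  coeffExist : Fin nEq → Fin nExist → R

/-- Satisfaction of a pp-formula by a tuple in a module. -/
def PPFormula.Sat {R : Type u} [Ring R] {n : ℕ} (φ : PPFormula R n)
    (M : Type u) [AddCommGroup M] [Module R M] (x : Fin n → M) : Prop :=
  ∃ y : Fin φ.nExist → M,
    ∀ i : Fin φ.nEq,
      (∑ j, φ.coeffFree i j • x j) + (∑ j, φ.coeffExist i j • y j) = 0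

/-- The solution set of a pp-formula in one free variable in a module. -/
def PPFormula.solSet {R : Type u} [Ring R] (φ : PPFormula R 1)
    (M : Type u) [AddCommGroup M] [Module R M] : Set M :=
  {m | φ.Sat M fun _ => m}

/-- A pp-formula `ψ(x)` in one free variable is low if `ψ[R] = 0`, i.e. `0` is the only
element of the left regular module `R` satisfying it. -/
def PPFormula.IsLow {R : Type u} [Ring R] (φ : PPFormula R 1) : Prop :=
  ∀ r : R, φ.Sat R (fun _ => r) → r = 0

/-- `sSet R M` is the set of elements of `M` satisfying some low pp-formula;
this is Martsinkovsky-Russell's radical `𝔰(M)`. -/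
def sSet (R : Type u) [Ring R] (M : Type u) [AddCommGroup M] [Module R M] : Set M :=
  {m | ∃ φ : PPFormula R 1, φ.IsLow ∧ φ.Sat M fun _ => m}

/-- A module is `𝔰`-torsion if every element satisfies some low pp-formula. -/
def IsSTorsion (R : Type u) [Ring R] (M : Type u) [AddCommGroup M] [Module R M] : Prop :=
  ∀ m : M, m ∈ sSet R M

/-- A linear map is a pure embedding if it is injective and pp-formulas are
reflected: any tuple whose image satisfies a pp-formula already satisfies it. -/
def IsPureEmb {R : Type u} [Ring R] {M N : Type u} [AddCommGroup M] [Module R M]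
    [AddCommGroup N] [Module R N] (f : M →ₗ[R] N) : Prop :=
  Function.Injective f ∧
    ∀ (k : ℕ) (φ : PPFormula R k) (x : Fin k → M), φ.Sat N (⇑f ∘ x) → φ.Sat M x

/-- `M` is a `K^{𝔰-Tor}`-pure-injective module: it is `𝔰`-torsion and any homomorphism
from an `𝔰`-torsion module to `M` extends along any pure embedding between `𝔰`-torsion
modules. -/
def IsKsTorPureInjective (R : Type u) [Ring R] (M : Type u)
    [AddCommGroup M] [Module R M] : Prop :=
  IsSTorsion R M ∧
    ∀ (N₁ N₂ : Type u) [AddCommGroup N₁] [Module R N₁] [AddCommGroup N₂] [Module R N₂],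
      IsSTorsion R N₁ → IsSTorsion R N₂ →
        ∀ (g : N₁ →ₗ[R] N₂), IsPureEmb g →
          ∀ f : N₁ →ₗ[R] M, ∃ h : N₂ →ₗ[R] M, h.comp g = f

/-- `M` is `Σ`-`K^{𝔰-Tor}`-pure-injective: every direct sum of copies of `M` is
`K^{𝔰-Tor}`-pure-injective. -/
def IsSigmaKsTorPureInjective (R : Type u) [Ring R] (M : Type u)
    [AddCommGroup M] [Module R M] : Prop :=
  ∀ I : Type u, IsKsTorPureInjective R (DirectSum I fun _ => M)

/-- `M` has the low-pp descending chain condition. -/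
def LowPPDCC (R : Type u) [Ring R] (M : Type u) [AddCommGroup M] [Module R M] : Prop :=
  ∀ φ : ℕ → PPFormula R 1, (φ 0).IsLow →
    (∀ n : ℕ, (φ (n + 1)).solSet M ⊆ (φ n).solSet M) →
      ∃ n₀ : ℕ, ∀ k : ℕ, n₀ ≤ k → (φ n₀).solSet M = (φ k).solSet M

/-- The class of `𝔰`-torsion left `R`-modules is nontrivial. -/
def KsTorNontrivial (R : Type u) [Ring R] : Prop :=
  ∃ (M : Type u) (_ : AddCommGroup M) (_ : Module R M), IsSTorsion R M ∧ Nontrivial M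

/-- `R` is right semihereditary: every finitely generated submodule of a projective
right `R`-module (i.e. left `Rᵐᵒᵖ`-module) is projective. -/
def RightSemihereditary (R : Type u) [Ring R] : Prop :=
  ∀ (P : Type u) [AddCommGroup P] [Module Rᵐᵒᵖ P], Module.Projective Rᵐᵒᵖ P →
    ∀ N : Submodule Rᵐᵒᵖ P, N.FG → Module.Projective Rᵐᵒᵖ ↥N

/-- Equality of the pp-types of `b₁` over `M` in `N₁` and of `b₂` over `M` in `N₂`,
where `M` is embedded in `N₁`, `N₂` via `i₁`, `i₂`. -/
def PPTypeEq (R : Type u) [Ring R] (n : ℕ) (M N₁ N₂ : Type u)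
    [AddCommGroup M] [Module R M] [AddCommGroup N₁] [Module R N₁]
    [AddCommGroup N₂] [Module R N₂]
    (i₁ : M →ₗ[R] N₁) (i₂ : M →ₗ[R] N₂) (b₁ : Fin n → N₁) (b₂ : Fin n → N₂) : Prop :=
  ∀ (l : ℕ) (φ : PPFormula R (n + l)) (a : Fin l → M),
    φ.Sat N₁ (Fin.append b₁ (⇑i₁ ∘ a)) ↔ φ.Sat N₂ (Fin.append b₂ (⇑i₂ ∘ a))

section PPAux

variable {R : Type u} [Ring R]

/-- Build a pp-formula from a system indexed by arbitrary finite types. -/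
noncomputable def ppMk {n : ℕ} {ι κ : Type} [Fintype ι] [Fintype κ]
    (d : ι → Fin n → R) (B : ι → κ → R) : PPFormula R n where
  nExist := Fintype.card κ
  nEq := Fintype.card ι
  coeffFree i j := d ((Fintype.equivFin ι).symm i) j
  coeffExist i j := B ((Fintype.equivFin ι).symm i) ((Fintype.equivFin κ).symm j)

theorem ppMk_sat {n : ℕ} {ι κ : Type} [Fintype ι] [Fintype κ]
    (d : ι → Fin n → R) (B : ι → κ → R) (M : Type u) [AddCommGroup M] [Module R M]
    (x : Fin n → M) :
    (ppMk d B).Sat M x ↔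
      ∃ y : κ → M, ∀ i, (∑ j, d i j • x j) + ∑ j, B i j • y j = 0 := by
  constructor
  · rintro ⟨y, hy⟩
    refine ⟨fun k => y (Fintype.equivFin κ k), fun i => ?_⟩
    have h := hy (Fintype.equivFin ι i)
    simp only [ppMk, Equiv.symm_apply_apply] at h
    rw [← h]
    congr 1
    exact Fintype.sum_equiv (Fintype.equivFin κ) _ _ (by simp)
  · rintro ⟨y, hy⟩
    refine ⟨fun k => y ((Fintype.equivFin κ).symm k), fun i => ?_⟩
    have h := hy ((Fintype.equivFin ι).symm i)
    rw [← h]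
    simp only [ppMk]
    congr 1
    exact Fintype.sum_equiv (Fintype.equivFin κ).symm _ _ (by simp)

theorem sat_map {n : ℕ} (φ : PPFormula R n) {M N : Type u} [AddCommGroup M] [Module R M]
    [AddCommGroup N] [Module R N] (f : M →ₗ[R] N) {x : Fin n → M} (h : φ.Sat M x) :
    φ.Sat N (fun j => f (x j)) := by
  obtain ⟨y, hy⟩ := h
  refine ⟨fun j => f (y j), fun i => ?_⟩
  have := congrArg f (hy i)
  simpa [map_add, map_sum] using this

theorem sat_zero {n : ℕ} (φ : PPFormula R n) (M : Type u) [AddCommGroup M] [Module R M] :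
    φ.Sat M (fun _ => 0) := ⟨fun _ => 0, by simp⟩

theorem sat_sub {n : ℕ} (φ : PPFormula R n) {M : Type u} [AddCommGroup M] [Module R M]
    {x x' : Fin n → M} (h : φ.Sat M x) (h' : φ.Sat M x') :
    φ.Sat M (fun j => x j - x' j) := by
  obtain ⟨y, hy⟩ := h
  obtain ⟨y', hy'⟩ := h'
  refine ⟨fun j => y j - y' j, fun i => ?_⟩
  have : _ - _ = (0 : M) - 0 := congrArg₂ (· - ·) (hy i) (hy' i)
  simp only [smul_sub, Finset.sum_sub_distrib]
  rw [sub_zero] at this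
  rw [← this]
  abel

/-- The key closure property for torsion elements. -/
theorem low_comb {M : Type u} [AddCommGroup M] [Module R M] {ι κ : Type} [Fintype ι] [Fintype κ]
    (B : ι → κ → R) (c : κ → R) (y : κ → M)
    (hy : ∀ i, (∑ l, B i l • y l) ∈ sSet R M)
    (hc : ∀ r : κ → R, (∀ i, ∑ l, B i l * r l = 0) → ∑ l, c l * r l = 0) :
    (∑ l, c l • y l) ∈ sSet R M := by
  classical
  choose ψ hlow w hw using hy
  let d' : (Unit ⊕ Σ i, Fin (ψ i).nEq) → Fin 1 → R := Sum.elim (fun _ _ => 1) (fun _ _ => 0)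
  let B' : (Unit ⊕ Σ i, Fin (ψ i).nEq) → (κ ⊕ Σ i, Fin (ψ i).nExist) → R :=
    Sum.elim (fun _ => Sum.elim (fun l => - c l) (fun _ => 0))
      (fun e => Sum.elim (fun l => (ψ e.1).coeffFree e.2 0 * B e.1 l)
        (fun t => if h : t.1 = e.1 then (ψ e.1).coeffExist e.2 (h ▸ t.2) else 0))
  have key : ∀ (N : Type u) [AddCommGroup N] [Module R N] (z : N)
      (v : (κ ⊕ Σ i, Fin (ψ i).nExist) → N),
      (∀ i, (∑ j, d' i j • z) + ∑ j, B' i j • v j = 0) ↔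
      (z = ∑ l, c l • v (Sum.inl l)) ∧ ∀ i, ∀ e : Fin (ψ i).nEq,
        (∑ j : Fin 1, (ψ i).coeffFree e j • ∑ l, B i l • v (Sum.inl l)) +
          ∑ j, (ψ i).coeffExist e j • v (Sum.inr ⟨i, j⟩) = 0 := by
    intro N _ _ z v
    rw [Sum.forall]
    refine and_congr ?_ ?_
    · simp [d', B', ← sub_eq_add_neg, sub_eq_zero]
    · rw [Sigma.forall]
      refine forall_congr' fun i => forall_congr' fun e => ?_
      have h1 : ∑ t : (Σ i, Fin (ψ i).nExist), B' (Sum.inr ⟨i, e⟩) (Sum.inr t) • v (Sum.inr t)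
          = ∑ j, (ψ i).coeffExist e j • v (Sum.inr ⟨i, j⟩) := by
        rw [Fintype.sum_sigma, Finset.sum_eq_single i]
        · simp [B']
        · intro i' _ hne
          simp [B', hne]
        · simp
      rw [Fintype.sum_sum_type, h1]
      simp [d', B', Finset.smul_sum, mul_smul]
  refine ⟨ppMk d' B', ?_, ?_⟩
  · intro r hr
    rw [ppMk_sat] at hr
    obtain ⟨v, hv⟩ := hr
    obtain ⟨h1, h2⟩ := (key R r v).1 hv
    rw [h1]
    apply hc (fun l => v (Sum.inl l))
    intro i
    exact hlow i _ ⟨fun j => v (Sum.inr ⟨i, j⟩), h2 i⟩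
  · rw [ppMk_sat]
    refine ⟨Sum.elim y (fun t => w t.1 t.2), (key M _ _).2 ⟨by simp, fun i e => ?_⟩⟩
    simpa using hw i e

/-- The torsion submodule. -/
def sSub (R : Type u) [Ring R] (M : Type u) [AddCommGroup M] [Module R M] : Submodule R M where
  carrier := sSet R M
  add_mem' := by
    intro a b ha hb
    have := low_comb (R := R) (M := M) (ι := Bool) (κ := Bool)
      (fun i j => if i = j then 1 else 0) (fun _ => 1) (fun i => if i then a else b)
      (by intro i; cases i <;> simp [ha, hb])
      (by
        intro r h
        have h1 := h true
        have h2 := h false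
        simp at h1 h2
        simp [h1, h2])
    simpa using this
  zero_mem' := by
    have := low_comb (R := R) (M := M) (ι := Fin 0) (κ := Fin 0)
      (fun i j => 0) (fun _ => 0) (fun i => 0) (by intro i; exact i.elim0) (by simp)
    simpa using this
  smul_mem' := by
    intro c a ha
    have := low_comb (R := R) (M := M) (ι := Unit) (κ := Unit)
      (fun i j => 1) (fun _ => c) (fun i => a)
      (by intro i; simp [ha])
      (by
        intro r h
        have h1 := h ()
        simp at h1
        simp [h1])
    simpa using this

theorem mem_sSub {M : Type u} [AddCommGroup M] [Module R M] {m : M} :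
    m ∈ sSub R M ↔ m ∈ sSet R M := Iff.rfl

theorem sSet_map {M N : Type u} [AddCommGroup M] [Module R M]
    [AddCommGroup N] [Module R N] (f : M →ₗ[R] N) {m : M} (h : m ∈ sSet R M) :
    f m ∈ sSet R N := by
  obtain ⟨φ, hφ, hs⟩ := h
  exact ⟨φ, hφ, sat_map φ f hs⟩


theorem semihered_matrix (hsh : RightSemihereditary R) {m k : ℕ} (B : Fin m → Fin k → R) :
    ∃ C : Fin k → Fin k → R, (∀ i l, ∑ j, B i j * C j l = B i l) ∧
      ∀ r : Fin k → R, (∀ i, ∑ l, B i l * r l = 0) → ∀ j, ∑ l, C j l * r l = 0 := by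
  classical
  let L : (Fin k → R) →ₗ[Rᵐᵒᵖ] (Fin m → R) :=
    { toFun := fun r i => ∑ j, B i j * r j
      map_add' := by intro x y; ext i; simp [mul_add, Finset.sum_add_distrib]
      map_smul' := by intro c x; ext i; simp [Finset.sum_mul, mul_assoc] }
  let eo : R ≃ₗ[Rᵐᵒᵖ] Rᵐᵒᵖ :=
    { toFun := MulOpposite.op
      invFun := MulOpposite.unop
      left_inv := fun _ => rfl
      right_inv := fun _ => rfl
      map_add' := fun _ _ => rfl
      map_smul' := fun _ _ => rfl }
  have : Module.Finite Rᵐᵒᵖ R := Module.Finite.equiv eo.symm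
  have : Module.Free Rᵐᵒᵖ R := Module.Free.of_equiv eo.symm
  have hfg : (LinearMap.range L).FG := by
    rw [LinearMap.range_eq_map]
    exact Submodule.FG.map _ (Module.Finite.fg_top)
  have hproj := hsh (Fin m → R) inferInstance (LinearMap.range L) hfg
  obtain ⟨s, hs⟩ := Module.projective_lifting_property L.rangeRestrict LinearMap.id
    L.surjective_rangeRestrict
  let p : (Fin k → R) →ₗ[Rᵐᵒᵖ] (Fin k → R) := s.comp L.rangeRestrict
  have hp : ∀ r, L (p r) = L r := by
    intro r
    have := congrArg Subtype.val (LinearMap.congr_fun hs (L.rangeRestrict r))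
    simpa [p] using this
  have hp0 : ∀ r, L r = 0 → p r = 0 := by
    intro r hr
    have : L.rangeRestrict r = 0 := Subtype.ext (by simpa using hr)
    simp [p, this]
  have hpr : ∀ r j, p r j = ∑ l, p (Pi.single l 1) j * r l := by
    intro r j
    have h : r = ∑ l, MulOpposite.op (r l) • (Pi.single l (1 : R) : Fin k → R) := by
      ext t
      simp [Finset.sum_apply, Pi.single_apply]
    conv_lhs => rw [h]
    simp [map_sum, Finset.sum_apply]
  refine ⟨fun j l => p (Pi.single l 1) j, ?_, ?_⟩
  · intro i l
    have := congrFun (hp (Pi.single l 1)) i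
    simpa [L, Pi.single_apply] using this
  · intro r hr j
    rw [← hpr, hp0 r (funext hr)]
    rfl

theorem sSub_pure (hsh : RightSemihereditary R) (M : Type u) [AddCommGroup M] [Module R M] :
    IsPureEmb (sSub R M).subtype := by
  refine ⟨Subtype.val_injective, ?_⟩
  rintro n φ x ⟨y, hy⟩
  obtain ⟨C, hC1, hC2⟩ := semihered_matrix hsh φ.coeffExist
  refine ⟨fun j => ⟨∑ l, C j l • y l, ?_⟩, ?_⟩
  · refine low_comb φ.coeffExist (C j) y ?_ (fun r hr => hC2 r hr j)
    intro i
    rw [eq_neg_of_add_eq_zero_right (hy i)]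
    refine (sSub R M).neg_mem (Submodule.sum_mem _ fun j _ => Submodule.smul_mem _ _ (x j).2)
  · intro i
    apply Subtype.ext
    have h := hy i
    simp only [Submodule.coe_add, Submodule.coe_sum, Submodule.coe_smul, Submodule.coe_zero]
    rw [← h]
    congr 1
    simp only [Finset.smul_sum]
    rw [Finset.sum_comm]
    refine Finset.sum_congr rfl fun l _ => ?_
    rw [← hC1 i l, Finset.sum_smul]
    simp [mul_smul]

theorem sSub_sTorsion (hsh : RightSemihereditary R) (M : Type u) [AddCommGroup M] [Module R M] :
    IsSTorsion R (sSub R M) := by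
  rintro ⟨m, φ, hφ, hs⟩
  exact ⟨φ, hφ, (sSub_pure hsh M).2 1 φ (fun _ => ⟨m, φ, hφ, hs⟩) hs⟩

theorem sat_pi {n : ℕ} (φ : PPFormula R n) {M : Type u} [AddCommGroup M] [Module R M]
    {I : Type u} {x : Fin n → I → M} (h : ∀ t, φ.Sat M (fun j => x j t)) : φ.Sat (I → M) x := by
  choose y hy using h
  refine ⟨fun j t => y t j, fun i => ?_⟩
  ext t
  simpa using hy t i

theorem sat_directSum {n : ℕ} (φ : PPFormula R n) {M : Type u} [AddCommGroup M] [Module R M]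
    {I : Type u} {x : Fin n → DirectSum I (fun _ => M)} :
    φ.Sat _ x ↔ ∀ t, φ.Sat M (fun j => x j t) := by
  classical
  constructor
  · intro h t
    exact sat_map φ (DirectSum.component R I (fun _ => M) t) h
  · intro h
    choose y hy using h
    let S : Finset I := Finset.univ.biUnion fun j => DFinsupp.support (x j)
    let y' : Fin φ.nExist → DirectSum I (fun _ => M) := fun j =>
      DirectSum.mk (fun _ => M) S (fun t => y t j)
    refine ⟨y', fun i => ?_⟩
    refine DFinsupp.ext fun t => ?_
    let ev : DirectSum I (fun _ => M) →ₗ[R] M := DirectSum.component R I (fun _ => M) t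
    have hev : ∀ z : DirectSum I (fun _ => M), z t = ev z := fun z => rfl
    refine (hev _).trans (Eq.trans ?_ (hev 0).symm)
    simp only [map_add, map_sum, map_smul, map_zero]
    have hx : ∀ j, ev (x j) = x j t := fun j => rfl
    by_cases ht : t ∈ S
    · have hy' : ∀ j, ev (y' j) = y t j := by
        intro j
        exact DirectSum.mk_apply_of_mem (β := fun _ => M) (f := fun t : (S : Set I) => y t j) ht
      simp only [hx, hy']
      exact hy t i
    · have hy' : ∀ j, ev (y' j) = 0 := by
        intro j
        exact DirectSum.mk_apply_of_notMem (β := fun _ => M) (f := fun t : (S : Set I) => y t j) ht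
      have hx' : ∀ j, x j t = 0 := by
        intro j
        by_contra hne
        exact ht (Finset.mem_biUnion.2 ⟨j, Finset.mem_univ _, DFinsupp.mem_support_iff.2 hne⟩)
      simp [hx, hy', hx']

theorem sTorsion_directSum {M : Type u} [AddCommGroup M] [Module R M] (hM : IsSTorsion R M)
    (I : Type u) : IsSTorsion R (DirectSum I fun _ => M) := by
  classical
  intro x
  change x ∈ sSub R (DirectSum I fun _ => M)
  induction x using DirectSum.induction_on with
  | zero => exact Submodule.zero_mem _
  | of i m => exact sSet_map (DirectSum.lof R I (fun _ => M) i) (hM m)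
  | add x y hx hy => exact Submodule.add_mem _ hx hy

theorem ksTor_equiv {A B : Type u} [AddCommGroup A] [Module R A] [AddCommGroup B] [Module R B]
    (e : A ≃ₗ[R] B) (h : IsKsTorPureInjective R A) : IsKsTorPureInjective R B := by
  refine ⟨fun b => ?_, ?_⟩
  · have := sSet_map e.toLinearMap (h.1 (e.symm b))
    simpa using this
  · intro N₁ N₂ _ _ _ _ h1 h2 g hg f
    obtain ⟨k, hk⟩ := h.2 N₁ N₂ h1 h2 g hg (e.symm.toLinearMap.comp f)
    refine ⟨e.toLinearMap.comp k, ?_⟩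
    rw [LinearMap.comp_assoc, hk]
    ext x
    simp

theorem lowDCC_directSum {M : Type u} [AddCommGroup M] [Module R M] (h : LowPPDCC R M)
    (I : Type u) : LowPPDCC R (DirectSum I fun _ => M) := by
  classical
  intro φ h0 hd
  have hmem : ∀ n (x : DirectSum I fun _ => M),
      x ∈ (φ n).solSet _ ↔ ∀ t, x t ∈ (φ n).solSet M := fun n x => sat_directSum (φ n)
  rcases isEmpty_or_nonempty I with hI | ⟨⟨t⟩⟩
  · refine ⟨0, fun k _ => ?_⟩
    ext x
    rw [hmem, hmem]
    simp
  · obtain ⟨n₀, hn⟩ := h φ h0 (by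
      intro n m hm
      have h1 : DirectSum.lof R I (fun _ => M) t m ∈ (φ (n + 1)).solSet _ :=
        sat_map (φ (n + 1)) (DirectSum.lof R I (fun _ => M) t) hm
      have h2 := (hmem n _).1 (hd n h1) t
      rwa [DirectSum.lof_apply] at h2)
    refine ⟨n₀, fun k hk => ?_⟩
    ext x
    rw [hmem, hmem, hn k hk]

theorem two_three (hsh : RightSemihereditary R) {M : Type u} [AddCommGroup M] [Module R M]
    (h : IsKsTorPureInjective R (DirectSum (ULift.{u} ℕ) fun _ => M)) : LowPPDCC R M := by
  classical
  intro φ h0 hd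
  have hanti : ∀ m n, m ≤ n → (φ n).solSet M ⊆ (φ m).solSet M := by
    intro m n hmn
    exact antitone_nat_of_succ_le (f := fun n => (φ n).solSet M) hd hmn
  by_contra hcon
  have hcon' : ∀ n, ∃ k, n ≤ k ∧ ∃ a, a ∈ (φ n).solSet M ∧ a ∉ (φ k).solSet M := by
    intro n
    by_contra hn
    push Not at hn
    exact hcon ⟨n, fun k hk => Set.Subset.antisymm (fun a ha => hn k hk a ha) (hanti _ _ hk)⟩
  choose K hK a ha hna using hcon'
  let J := ULift.{u} ℕ
  let D := DirectSum J fun _ => M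
  let T := sSub R (J → M)
  let g0 : D →ₗ[R] (J → M) := LinearMap.pi fun t => DirectSum.component R J (fun _ => M) t
  let g : D →ₗ[R] T := g0.codRestrict T fun x => sSet_map g0 (h.1 x)
  have hg : IsPureEmb g := by
    constructor
    · intro x y hxy
      refine DFinsupp.ext fun t => ?_
      exact congrFun (congrArg Subtype.val hxy) t
    · intro k ψ x hx
      rw [sat_directSum]
      intro t
      exact sat_map ψ ((LinearMap.proj t : (J → M) →ₗ[R] M).comp T.subtype) hx
  obtain ⟨r, hr⟩ := h.2 D T h.1 (sSub_sTorsion hsh _) g hg LinearMap.id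
  have haT : (fun t : J => a t.down) ∈ T :=
    ⟨φ 0, h0, sat_pi (φ 0) fun t => hanti 0 _ (Nat.zero_le _) (ha t.down)⟩
  let av : T := ⟨fun t : J => a t.down, haT⟩
  obtain ⟨n, hn⟩ : ∃ n : J, r av n = 0 := by
    obtain ⟨n, hn⟩ := Infinite.exists_notMem_finset (DFinsupp.support (r av))
    exact ⟨n, by simpa using hn⟩
  let k := K n.down
  have hnk : n.down < k := by
    refine lt_of_le_of_ne (hK _) fun he => hna n.down ?_
    have := ha n.down
    change a n.down ∈ (φ k).solSet M
    rwa [← he]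
  let S : Finset J := (Finset.range k).map Equiv.ulift.symm.toEmbedding
  have hS : ∀ t : J, t ∈ S ↔ t.down < k := by
    intro t
    simp [S]
    rfl
  let u : D := DirectSum.mk (fun _ => M) S fun t => a t.1.down
  have hu1 : ∀ t : J, t.down < k → u t = a t.down := fun t ht =>
    DirectSum.mk_apply_of_mem ((hS t).2 ht)
  have hu2 : ∀ t : J, ¬ t.down < k → u t = 0 := fun t ht =>
    DirectSum.mk_apply_of_notMem (mt (hS t).1 ht)
  have hsat : (φ k).Sat T (fun _ => av - g u) := by
    refine (sSub_pure hsh (J → M)).2 1 (φ k) _ ?_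
    refine sat_pi (φ k) fun t => ?_
    change (φ k).Sat M fun _ => a t.down - u t
    by_cases ht : t.down < k
    · rw [hu1 t ht, sub_self]
      exact sat_zero _ _
    · rw [hu2 t ht, sub_zero]
      exact hanti _ _ (not_lt.1 ht) (ha t.down)
  have h2 := (sat_directSum (φ k)).1 (sat_map (φ k) r hsat) n
  have h3 : r (g u) = u := LinearMap.congr_fun hr u
  have h4 : (r (av - g u)) n = - a n.down := by
    rw [map_sub, h3]
    change r av n - u n = _
    rw [hn, hu1 n hnk, zero_sub]
  rw [h4] at h2
  apply hna n.down
  have h5 := sat_sub (φ k) (sat_zero (φ k) M) h2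
  simp only [zero_sub, neg_neg] at h5
  exact h5

/-- A relation between `N₂` and `N` preserving pp-formulas. -/
def PPRel {N₂ N : Type u} [AddCommGroup N₂] [Module R N₂] [AddCommGroup N] [Module R N]
    (G : Submodule R (N₂ × N)) : Prop :=
  ∀ (ι κ : Type) [Fintype ι] [Fintype κ] (B : ι → κ → R) (c : ι → N₂ × N), (∀ i, c i ∈ G) →
    (∃ y : κ → N₂, ∀ i, ∑ j, B i j • y j = (c i).1) →
    ∃ y : κ → N, ∀ i, ∑ j, B i j • y j = (c i).2

/-- Finite systems with parameters in the relation. -/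
structure PPSys (R : Type u) [Ring R] (X : Type u) : Type (u + 1) where
  ι : Type
  κ : Type
  fι : Fintype ι
  fκ : Fintype κ
  d : ι → R
  B : ι → κ → R
  c : ι → X

attribute [instance] PPSys.fι PPSys.fκ

/-- The formula of the system with zero parameters. -/
noncomputable def PPSys.formula {X : Type u} (s : PPSys R X) : PPFormula R 1 :=
  ppMk (fun i _ => s.d i) s.B

theorem PPSys.mem_formula {X : Type u} (s : PPSys R X) (M : Type u) [AddCommGroup M] [Module R M]
    (x : M) : x ∈ s.formula.solSet M ↔
      ∃ y : s.κ → M, ∀ i, s.d i • x + ∑ j, s.B i j • y j = 0 := by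
  refine (ppMk_sat _ _ _ _).trans ?_
  simp

/-- Conjunction of systems. -/
def PPSys.conj {X : Type u} (s t : PPSys R X) : PPSys R X where
  ι := s.ι ⊕ t.ι
  κ := s.κ ⊕ t.κ
  fι := inferInstance
  fκ := inferInstance
  d := Sum.elim s.d t.d
  B := Sum.elim (fun i => Sum.elim (s.B i) fun _ => 0) (fun i => Sum.elim (fun _ => 0) (t.B i))
  c := Sum.elim s.c t.c

/-- Satisfaction of a system with parameters. -/
def PPSys.Holds {X : Type u} (s : PPSys R X) {M : Type u} [AddCommGroup M] [Module R M]
    (v : X → M) (x : M) : Prop :=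
  ∃ y : s.κ → M, ∀ i, s.d i • x + ∑ j, s.B i j • y j = v (s.c i)

theorem PPSys.conj_holds {X : Type u} (s t : PPSys R X) {M : Type u} [AddCommGroup M] [Module R M]
    (v : X → M) (x : M) : (s.conj t).Holds v x ↔ s.Holds v x ∧ t.Holds v x := by
  constructor
  · rintro ⟨y, hy⟩
    refine ⟨⟨fun j => y (Sum.inl j), fun i => ?_⟩, ⟨fun j => y (Sum.inr j), fun i => ?_⟩⟩
    · have := hy (Sum.inl i)
      change _ + ∑ j : s.κ ⊕ t.κ, _ = _ at this
      rw [Fintype.sum_sum_type] at this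
      simpa [PPSys.conj] using this
    · have := hy (Sum.inr i)
      change _ + ∑ j : s.κ ⊕ t.κ, _ = _ at this
      rw [Fintype.sum_sum_type] at this
      simpa [PPSys.conj] using this
  · rintro ⟨⟨y, hy⟩, ⟨z, hz⟩⟩
    refine ⟨Sum.elim y z, ?_⟩
    rintro (i | i)
    · change _ + ∑ j : s.κ ⊕ t.κ, _ = _
      rw [Fintype.sum_sum_type]
      simpa [PPSys.conj] using hy i
    · change _ + ∑ j : s.κ ⊕ t.κ, _ = _
      rw [Fintype.sum_sum_type]
      simpa [PPSys.conj] using hz i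

theorem PPSys.formula_iff {X : Type u} (s : PPSys R X) {M : Type u} [AddCommGroup M] [Module R M]
    (x : M) : x ∈ s.formula.solSet M ↔ s.Holds (fun _ => 0) x := s.mem_formula M x

theorem PPSys.holds_sub {X : Type u} (s : PPSys R X) {M : Type u} [AddCommGroup M] [Module R M]
    {v v' : X → M} {x x' : M} (h : s.Holds v x) (h' : s.Holds v' x') :
    s.Holds (fun t => v t - v' t) (x - x') := by
  obtain ⟨y, hy⟩ := h
  obtain ⟨z, hz⟩ := h'
  refine ⟨fun j => y j - z j, fun i => ?_⟩
  change _ = v (s.c i) - v' (s.c i)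
  rw [← hy i, ← hz i]
  simp only [smul_sub, Finset.sum_sub_distrib]
  abel

/-- The one-element extension step: realising a pp-type. -/
theorem realise {N₂ N : Type u} [AddCommGroup N₂] [Module R N₂] [AddCommGroup N] [Module R N]
    (hN : LowPPDCC R N) (G : Submodule R (N₂ × N)) (hG : PPRel G) (b : N₂)
    (hb : b ∈ sSet R N₂) :
    ∃ c : N, ∀ s : PPSys R G, s.Holds (fun t => t.1.1) b → s.Holds (fun t => t.1.2) c := by
  classical
  have hsat : ∀ s : PPSys R G, s.Holds (fun t => t.1.1) b →
      ∃ x, s.Holds (M := N) (fun t => t.1.2) x := by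
    rintro s ⟨y, hy⟩
    obtain ⟨z, hz⟩ := hG s.ι (Option s.κ) (fun i o => Option.elim o (s.d i) (s.B i))
      (fun i => (s.c i).1) (fun i => (s.c i).2)
      ⟨fun j => Option.elim j b y, fun i => by
        rw [Fintype.sum_option]
        exact hy i⟩
    refine ⟨z none, fun j => z (some j), fun i => ?_⟩
    have := hz i
    rw [Fintype.sum_option] at this
    exact this
  obtain ⟨ψ, hψ, w, hw⟩ := hb
  let s0 : PPSys R G :=
    { ι := Fin ψ.nEq, κ := Fin ψ.nExist, fι := inferInstance, fκ := inferInstance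
      d := fun i => ψ.coeffFree i 0, B := ψ.coeffExist, c := fun _ => 0 }
  have hs0 : s0.Holds (M := N₂) (fun t => t.1.1) b := ⟨w, fun i => by
    have := hw i
    simp only [Finset.univ_unique, Finset.sum_singleton] at this
    exact this⟩
  have hs0low : s0.formula.IsLow := by
    intro r hr
    obtain ⟨y, hy⟩ := (s0.mem_formula R r).1 hr
    exact hψ r ⟨y, fun i => by simpa using hy i⟩
  obtain ⟨s, hs, hmin⟩ : ∃ s : PPSys R G, s.Holds (M := N₂) (fun t => t.1.1) b ∧
      ∀ t : PPSys R G, t.Holds (M := N₂) (fun t => t.1.1) b →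
        t.formula.solSet N ⊆ s.formula.solSet N → t.formula.solSet N = s.formula.solSet N := by
    by_contra hcon
    have hcon' : ∀ s : {s : PPSys R G // s.Holds (M := N₂) (fun t => t.1.1) b},
        ∃ t : {s : PPSys R G // s.Holds (M := N₂) (fun t => t.1.1) b},
          t.1.formula.solSet N ⊆ s.1.formula.solSet N ∧
          t.1.formula.solSet N ≠ s.1.formula.solSet N := by
      rintro ⟨s, hs⟩
      by_contra hns
      refine hcon ⟨s, hs, fun t ht hts => ?_⟩
      by_contra hne
      exact hns ⟨⟨t, ht⟩, hts, hne⟩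
    choose nx hnx hne using hcon'
    let q : ℕ → {s : PPSys R G // s.Holds (M := N₂) (fun t => t.1.1) b} :=
      fun n => nx^[n] ⟨s0, hs0⟩
    have hq : ∀ n, q (n + 1) = nx (q n) := fun n => Function.iterate_succ_apply' _ _ _
    obtain ⟨n₀, hn⟩ := hN (fun n => (q n).1.formula) hs0low (by
      intro n
      simp only [hq]
      exact hnx _)
    have := hn (n₀ + 1) (Nat.le_succ _)
    simp only [hq] at this
    exact hne _ this.symm
  obtain ⟨c, hc⟩ := hsat s hs
  refine ⟨c, fun t ht => ?_⟩
  have hst : (s.conj t).Holds (M := N₂) (fun t => t.1.1) b := (s.conj_holds t _ _).2 ⟨hs, ht⟩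
  obtain ⟨c', hc'⟩ := hsat _ hst
  obtain ⟨h1, h2⟩ := (s.conj_holds t _ _).1 hc'
  have heq := hmin (s.conj t) hst (by
    intro x hx
    rw [PPSys.formula_iff] at hx ⊢
    exact ((s.conj_holds t _ _).1 hx).1)
  have h3 : c' - c ∈ s.formula.solSet N := by
    rw [PPSys.formula_iff]
    have := s.holds_sub h1 hc
    simpa using this
  rw [← heq, PPSys.formula_iff] at h3
  have h4 := t.holds_sub h2 ((s.conj_holds t _ _).1 h3).2
  simpa using h4

theorem three_one {N : Type u} [AddCommGroup N] [Module R N] (htor : IsSTorsion R N)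
    (hN : LowPPDCC R N) : IsKsTorPureInjective R N := by
  classical
  refine ⟨htor, ?_⟩
  intro N₁ N₂ _ _ _ _ h1 h2 g hg f
  let G0 : Submodule R (N₂ × N) := LinearMap.range (g.prod f)
  have hG0 : PPRel G0 := by
    intro ι κ _ _ B c hc hy
    choose a ha using hc
    obtain ⟨y, hy⟩ := hy
    let e := Fintype.equivFin ι
    let d : ι → Fin (Fintype.card ι) → R := fun i j => if j = e i then -1 else 0
    have hs : (ppMk d B).Sat N₁ (fun j => a (e.symm j)) := by
      refine hg.2 _ _ _ ?_
      rw [ppMk_sat]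
      refine ⟨y, fun i => ?_⟩
      have := congrArg Prod.fst (ha i)
      change g (a i) = _ at this
      simp [d, hy, ← this]
    have hs' := sat_map _ f hs
    rw [ppMk_sat] at hs'
    obtain ⟨z, hz⟩ := hs'
    refine ⟨z, fun i => ?_⟩
    have h3 := hz i
    have := congrArg Prod.snd (ha i)
    change f (a i) = _ at this
    simp only [d, ite_smul, neg_smul, one_smul, zero_smul, Finset.sum_ite_eq', Finset.sum_ite_eq,
      Finset.mem_univ, if_true, Equiv.symm_apply_apply, this] at h3
    exact (neg_add_eq_zero.1 h3).symm
  obtain ⟨G, hle, hmax⟩ := zorn_le_nonempty₀ {G : Submodule R (N₂ × N) | PPRel G} (by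
    intro C hC hchain G1 hG1
    refine ⟨sSup C, ?_, fun G hG => le_sSup hG⟩
    intro ι κ _ _ B c hc hy
    have hdir : DirectedOn (· ≤ ·) C := hchain.directedOn
    have hc' : ∀ i, ∃ G : C, c i ∈ G.1 := by
      intro i
      obtain ⟨G, hG, hm⟩ := (Submodule.mem_sSup_of_directed ⟨G1, hG1⟩ hdir).1 (hc i)
      exact ⟨⟨G, hG⟩, hm⟩
    choose F hF using hc'
    have : Nonempty C := ⟨⟨G1, hG1⟩⟩
    obtain ⟨Z, hZ⟩ := (directedOn_iff_directed.1 hdir).finite_le F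
    exact hC Z.2 ι κ B c (fun i => hZ i (hF i)) hy) G0 hG0
  have hG : PPRel G := hmax.prop
  have hfun : ∀ x : N, ((0 : N₂), x) ∈ G → x = 0 := by
    intro x hx
    obtain ⟨y, hy⟩ := hG Unit (Fin 0) (fun _ _ => 0) (fun _ => (0, x)) (fun _ => hx)
      ⟨fun _ => 0, by simp⟩
    simpa using (hy ()).symm
  have huniq : ∀ (z : N₂) (x x' : N), (z, x) ∈ G → (z, x') ∈ G → x = x' := by
    intro z x x' hx hx'
    have := G.sub_mem hx hx'
    exact sub_eq_zero.1 (hfun _ (by simpa using this))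
  have htot : ∀ b : N₂, ∃ c : N, (b, c) ∈ G := by
    intro b
    obtain ⟨c, hc⟩ := realise hN G hG b (h2 b)
    refine ⟨c, ?_⟩
    have hG' : PPRel (G ⊔ Submodule.span R {(b, c)}) := by
      intro ι κ _ _ B v hv hy
      obtain ⟨y, hy⟩ := hy
      have hv' : ∀ i, ∃ γ : G, ∃ r : R, γ.1 + r • (b, c) = v i := by
        intro i
        obtain ⟨γ, hγ, w, hw, hs⟩ := Submodule.mem_sup.1 (hv i)
        obtain ⟨r, rfl⟩ := Submodule.mem_span_singleton.1 hw
        exact ⟨⟨γ, hγ⟩, r, hs⟩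
      choose γ r hγ using hv'
      let s : PPSys R G :=
        { ι := ι, κ := κ, fι := inferInstance, fκ := inferInstance
          d := fun i => - r i, B := B, c := γ }
      obtain ⟨z, hz⟩ := hc s ⟨y, fun i => by
        change (- r i) • b + ∑ j, B i j • y j = (γ i).1.1
        rw [hy i, ← hγ i]
        simp⟩
      refine ⟨z, fun i => ?_⟩
      have h3 : (- r i) • c + ∑ j, B i j • z j = (γ i).1.2 := hz i
      rw [← hγ i]
      simp only [Prod.snd_add, Prod.smul_snd]
      rw [← h3]
      simp
    have := hmax.le_of_ge hG' le_sup_left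
    exact this (Submodule.mem_sup_right (Submodule.mem_span_singleton_self _))
  choose k hk using htot
  refine ⟨{ toFun := k, map_add' := ?_, map_smul' := ?_ }, ?_⟩
  · intro x y
    exact huniq _ _ _ (hk _) (G.add_mem (hk x) (hk y))
  · intro r x
    exact huniq _ _ _ (hk _) (G.smul_mem r (hk x))
  · ext x
    exact huniq (g x) _ _ (hk _) (hle ⟨x, rfl⟩)

end PPAux

/-- **Lemma.** Assume `R` is right semihereditary, the class of `𝔰`-torsion modules is
nontrivial, and `M` is `𝔰`-torsion.  The following are equivalent:
(1) `M` is `Σ`-`K^{𝔰-Tor}`-pure-injective;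
(2) `M^{(ℵ₀)}` is `K^{𝔰-Tor}`-pure-injective;
(3) `M` has the low-pp descending chain condition. -/
theorem sigmaKsTorPureInjective_tfae (R : Type u) [Ring R]
    (hsh : RightSemihereditary R) (hnt : KsTorNontrivial R)
    (M : Type u) [AddCommGroup M] [Module R M] (hM : IsSTorsion R M) :
    List.TFAE
      [ IsSigmaKsTorPureInjective R M,
        IsKsTorPureInjective R (DirectSum ℕ fun _ => M),
        LowPPDCC R M ] := by
  have e : (DirectSum (ULift.{u} ℕ) fun _ => M) ≃ₗ[R] (DirectSum ℕ fun _ => M) :=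
    DirectSum.lequivCongrLeft R Equiv.ulift
  tfae_have 1 → 2 := fun h => ksTor_equiv e (h (ULift.{u} ℕ))
  tfae_have 2 → 3 := fun h => two_three hsh (ksTor_equiv e.symm h)
  tfae_have 3 → 1 := fun h I => three_one (sTorsion_directSum hM I) (lowDCC_directSum h I)
  tfae_finish
end

section
/- Assume R is right semihereditary and M, N are s-torsion left R-modules. Then: (a) if N is Σ-K^{s-Tor}-pure-injective, then N is K^{s-Tor}-pure-injective; (b) if M ≤_p N and N is Σ-K^{s-Tor}-pure-injective, then M is Σ-K^{s-Tor}-pure-injective; (c) if M is elementarily equivalent to N and N is Σ-K^{s-Tor}-pure-injective, then M is Σ-K^{s-Tor}-pure-injective. -/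
/- Core notions: pp-formulas, low formulas, s-torsion modules, pure embeddings. -/

universe u

open Cardinal

/- The first-order language of left `R`-modules and its interpretation in modules. -/

/-- The first-order language of left `R`-modules: a constant `0`, a binary function
`+`, and a unary function for scalar multiplication by each `r : R`. -/
def moduleLang (R : Type u) : FirstOrder.Language.{u, 0} where
  Functions n :=
    match n with
    | 0 => PUnit
    | 1 => R
    | 2 => PUnit
    | _ + 3 => PEmpty
  Relations _ := PEmpty

/-- The canonical interpretation of the language of `R`-modules in an `R`-module. -/
instance moduleLangStructure (R : Type u) [Ring R] (M : Type u)
    [AddCommGroup M] [Module R M] : (moduleLang R).Structure M where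
  funMap {n} f x :=
    match n, f with
    | 0, _ => 0
    | 1, r => (show R from r) • x 0
    | 2, _ => x 0 + x 1
  RelMap {n} r := PEmpty.elim r

namespace KsTor

/-! ### Basic facts on pp-formulas -/

/-- Conjunction of two pp-formulas in one free variable. -/
def conj {R : Type u} [Ring R] (φ ψ : PPFormula R 1) : PPFormula R 1 where
  nExist := φ.nExist + ψ.nExist
  nEq := φ.nEq + ψ.nEq
  coeffFree := fun i => Fin.addCases (fun i => φ.coeffFree i) (fun i => ψ.coeffFree i) i
  coeffExist := fun i =>
    Fin.addCases (fun i => Fin.addCases (fun j => φ.coeffExist i j) (fun _ => 0))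
      (fun i => Fin.addCases (fun _ => 0) (fun j => ψ.coeffExist i j)) i

/-- A pp-formula with the equations `… = 0` replaced by arbitrary conditions `Q i (…)`. -/
def Holds {R : Type u} [Ring R] (φ : PPFormula R 1) {X : Type u} [AddCommGroup X] [Module R X]
    (x : X) (Q : Fin φ.nEq → X → Prop) : Prop :=
  ∃ y : Fin φ.nExist → X, ∀ i, Q i (φ.coeffFree i 0 • x + ∑ j, φ.coeffExist i j • y j)

theorem holds_conj {R : Type u} [Ring R] (φ ψ : PPFormula R 1) {X : Type u} [AddCommGroup X]
    [Module R X] (x : X) (Q : Fin (φ.nEq + ψ.nEq) → X → Prop) :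
    Holds (conj φ ψ) x Q ↔
      Holds φ x (fun i => Q (Fin.castAdd _ i)) ∧ Holds ψ x (fun i => Q (Fin.natAdd _ i)) := by
  change (∃ y : Fin (φ.nExist + ψ.nExist) → X, ∀ i : Fin (φ.nEq + ψ.nEq),
    Q i (((Fin.addCases (fun i => φ.coeffFree i) (fun i => ψ.coeffFree i) i : Fin 1 → R) 0) • x +
      ∑ j : Fin (φ.nExist + ψ.nExist), ((Fin.addCases
        (fun i => Fin.addCases (fun j => φ.coeffExist i j) (fun _ => 0))
      (fun i => Fin.addCases (fun _ => 0) (fun j => ψ.coeffExist i j)) i :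
        Fin (φ.nExist + ψ.nExist) → R) j) • y j)) ↔ _
  constructor
  · rintro ⟨y, hy⟩
    refine ⟨⟨fun j => y (Fin.castAdd _ j), fun i => ?_⟩,
      ⟨fun j => y (Fin.natAdd _ j), fun i => ?_⟩⟩
    · have := hy (Fin.castAdd _ i)
      simpa [Fin.sum_univ_add] using this
    · have := hy (Fin.natAdd _ i)
      simpa [Fin.sum_univ_add] using this
  · rintro ⟨⟨y, hy⟩, ⟨z, hz⟩⟩
    refine ⟨fun j : Fin (φ.nExist + ψ.nExist) => Fin.addCases y z j,
      fun i : Fin (φ.nEq + ψ.nEq) => ?_⟩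
    refine Fin.addCases (fun i => ?_) (fun i => ?_) i
    · simpa [Fin.sum_univ_add] using hy i
    · simpa [Fin.sum_univ_add] using hz i

theorem sat_iff_holds {R : Type u} [Ring R] (φ : PPFormula R 1) {X : Type u} [AddCommGroup X]
    [Module R X] (x : X) : φ.Sat X (fun _ => x) ↔ Holds φ x (fun _ t => t = 0) := by
  simp [PPFormula.Sat, Holds]

theorem sat_conj {R : Type u} [Ring R] (φ ψ : PPFormula R 1) {X : Type u} [AddCommGroup X]
    [Module R X] (x : X) :
    (conj φ ψ).Sat X (fun _ => x) ↔ φ.Sat X (fun _ => x) ∧ ψ.Sat X (fun _ => x) := by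
  rw [sat_iff_holds, sat_iff_holds, sat_iff_holds]
  exact holds_conj φ ψ x (fun _ t => t = 0)

theorem sat_map {R : Type u} [Ring R] {n : ℕ} (φ : PPFormula R n) {X Y : Type u} [AddCommGroup X]
    [Module R X] [AddCommGroup Y] [Module R Y] (f : X →ₗ[R] Y) (x : Fin n → X)
    (h : φ.Sat X x) : φ.Sat Y (fun j => f (x j)) := by
  obtain ⟨y, hy⟩ := h
  refine ⟨fun j => f (y j), fun i => ?_⟩
  have := congrArg f (hy i)
  simpa using this

theorem sat_sub {R : Type u} [Ring R] (φ : PPFormula R 1) {X : Type u} [AddCommGroup X]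
    [Module R X] {x y : X} (hx : φ.Sat X (fun _ => x)) (hy : φ.Sat X (fun _ => y)) :
    φ.Sat X (fun _ => x - y) := by
  obtain ⟨u, hu⟩ := hx
  obtain ⟨v, hv⟩ := hy
  refine ⟨fun j => u j - v j, fun i => ?_⟩
  have h1 := hu i
  have h2 := hv i
  simp only [smul_sub, Finset.sum_sub_distrib]
  rw [sub_add_sub_comm, h1, h2, sub_zero]

theorem low_conj {R : Type u} [Ring R] (φ ψ : PPFormula R 1) (h : φ.IsLow) :
    (conj φ ψ).IsLow := fun r hr => h r ((sat_conj φ ψ r).1 hr).1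

/-! ### The `s`-torsion submodule -/

theorem mem_sSet_of_system {R : Type u} [Ring R] {ι κ : Type} [Fintype ι] [Fintype κ]
    (C : ι → κ → R) (t : κ → R)
    (hlow : ∀ y : κ → R, (∀ i, ∑ j, C i j * y j = 0) → ∑ j, t j * y j = 0)
    {X : Type u} [AddCommGroup X] [Module R X] (y : κ → X) (hy : ∀ i, ∑ j, C i j • y j = 0) :
    ∑ j, t j • y j ∈ sSet R X := by
  let eκ := Fintype.equivFin κ
  let eι := Fintype.equivFin (Option ι)
  let A : Option ι → R := fun o => o.elim (-1) (fun _ => 0)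
  let B : Option ι → κ → R := fun o => o.elim t C
  let φ : PPFormula R 1 := ⟨Fintype.card κ, Fintype.card (Option ι),
    fun i _ => A (eι.symm i), fun i j => B (eι.symm i) (eκ.symm j)⟩
  have key : ∀ (X : Type u) [AddCommGroup X] [Module R X] (x : X),
      φ.Sat X (fun _ => x) ↔ ∃ y : κ → X, ∀ i, A i • x + ∑ j, B i j • y j = 0 := by
    intro X _ _ x
    constructor
    · rintro ⟨y, hy⟩
      refine ⟨fun j => y (eκ j), fun i => ?_⟩
      have := hy (eι i)
      rw [← eκ.sum_comp] at this
      simpa [φ] using this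
    · rintro ⟨y, hy⟩
      refine ⟨fun j => y (eκ.symm j), fun i => ?_⟩
      have := hy (eι.symm i)
      rw [← eκ.symm.sum_comp] at this
      simpa [φ] using this
  refine ⟨φ, ?_, ?_⟩
  · intro r hr
    obtain ⟨y, hy⟩ := (key R r).1 hr
    have h0 := hy none
    have h1 := hlow y (fun i => by simpa [A, B] using hy (some i))
    simp only [A, B, Option.elim, smul_eq_mul, h1] at h0
    simpa using h0
  · rw [key]
    refine ⟨y, fun i => ?_⟩
    cases i with
    | none => simp [A, B]
    | some i => simpa [A, B] using hy i

theorem sSet_smul {R : Type u} [Ring R] {X : Type u} [AddCommGroup X] [Module R X] (r : R) {x : X}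
    (hx : x ∈ sSet R X) : r • x ∈ sSet R X := by
  obtain ⟨φ, hφ, y, hy⟩ := hx
  have := mem_sSet_of_system (ι := Fin φ.nEq) (κ := Fin 1 ⊕ Fin φ.nExist)
    (fun i => Sum.elim (φ.coeffFree i) (φ.coeffExist i))
    (Sum.elim (fun _ => r) (fun _ => 0))
    (by
      intro y hy
      simp only [Fintype.sum_sum_type, Sum.elim_inl, Sum.elim_inr] at hy
      have := hφ (y (Sum.inl 0)) ⟨fun j => y (Sum.inr j), fun i => by simpa using hy i⟩
      simp [this])
    (Sum.elim (fun _ => x) y)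
    (by simpa using hy)
  simpa using this

theorem sSet_add {R : Type u} [Ring R] {X : Type u} [AddCommGroup X] [Module R X] {x x' : X}
    (hx : x ∈ sSet R X) (hx' : x' ∈ sSet R X) : x + x' ∈ sSet R X := by
  obtain ⟨φ, hφ, y, hy⟩ := hx
  obtain ⟨ψ, hψ, z, hz⟩ := hx'
  have := mem_sSet_of_system (ι := Fin φ.nEq ⊕ Fin ψ.nEq)
    (κ := (Fin 1 ⊕ Fin φ.nExist) ⊕ (Fin 1 ⊕ Fin ψ.nExist))
    (Sum.elim (fun i => Sum.elim (Sum.elim (φ.coeffFree i) (φ.coeffExist i)) (fun _ => 0))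
      (fun i => Sum.elim (fun _ => 0) (Sum.elim (ψ.coeffFree i) (ψ.coeffExist i))))
    (Sum.elim (Sum.elim (fun _ => 1) (fun _ => 0)) (Sum.elim (fun _ => 1) (fun _ => 0)))
    (by
      intro y hy
      have h1 := hφ (y (Sum.inl (Sum.inl 0))) ⟨fun j => y (Sum.inl (Sum.inr j)), fun i => by
        simpa using hy (Sum.inl i)⟩
      have h2 := hψ (y (Sum.inr (Sum.inl 0))) ⟨fun j => y (Sum.inr (Sum.inr j)), fun i => by
        simpa using hy (Sum.inr i)⟩
      simp [h1, h2])
    (Sum.elim (Sum.elim (fun _ => x) y) (Sum.elim (fun _ => x') z))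
    (by
      rintro (i | i)
      · simpa using hy i
      · simpa using hz i)
  simpa using this

theorem sSet_zero {R : Type u} [Ring R] {X : Type u} [AddCommGroup X] [Module R X] :
    (0 : X) ∈ sSet R X := by
  have := mem_sSet_of_system (R := R) (ι := Fin 0) (κ := Fin 0) (X := X)
    (fun _ _ => 0) (fun _ => 0) (by simp) (fun _ => 0) (by simp)
  simpa using this

/-- The submodule of elements satisfying a low formula. -/
def sSub (R : Type u) [Ring R] (X : Type u) [AddCommGroup X] [Module R X] : Submodule R X where
  carrier := sSet R X
  add_mem' := sSet_add
  zero_mem' := sSet_zero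
  smul_mem' := fun r _ hx => sSet_smul r hx

theorem sSet_map {R : Type u} [Ring R] {X Y : Type u} [AddCommGroup X]
    [Module R X] [AddCommGroup Y] [Module R Y] (f : X →ₗ[R] Y) {x : X} (h : x ∈ sSet R X) :
    f x ∈ sSet R Y := by
  obtain ⟨φ, hφ, hx⟩ := h
  exact ⟨φ, hφ, sat_map φ f _ hx⟩

/-! ### Use of right semiheredity -/

theorem exists_matrix {R : Type u} [Ring R] (hsh : RightSemihereditary R) {m k : ℕ}
    (B : Fin m → Fin k → R) :
    ∃ G : Fin k → Fin k → R, (∀ i j, ∑ a, B i a * G a j = B i j) ∧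
      ∀ v : Fin k → R, (∀ i, ∑ j, B i j * v j = 0) → ∀ a, ∑ j, G a j * v j = 0 := by
  let e : R ≃ₗ[Rᵐᵒᵖ] Rᵐᵒᵖ :=
    { toFun := MulOpposite.op
      invFun := MulOpposite.unop
      map_add' := fun _ _ => rfl
      map_smul' := fun _ _ => rfl
      left_inv := fun _ => rfl
      right_inv := fun _ => rfl }
  have hfree : Module.Free Rᵐᵒᵖ R := Module.Free.of_equiv e.symm
  have hfin : Module.Finite Rᵐᵒᵖ R := Module.Finite.equiv e.symm
  let L : (Fin k → R) →ₗ[Rᵐᵒᵖ] (Fin m → R) :=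
    { toFun := fun v i => ∑ j, B i j * v j
      map_add' := fun v w => by ext i; simp [mul_add, Finset.sum_add_distrib]
      map_smul' := fun r v => by ext i; simp [Finset.sum_mul, mul_assoc] }
  have hproj : Module.Projective Rᵐᵒᵖ (LinearMap.range L) :=
    hsh (Fin m → R) inferInstance (LinearMap.range L) (by
      rw [LinearMap.range_eq_map]; exact Submodule.FG.map _ Module.Finite.fg_top)
  obtain ⟨s, hs⟩ := Module.projective_lifting_property L.rangeRestrict LinearMap.id
    L.surjective_rangeRestrict
  let F := s ∘ₗ L.rangeRestrict
  have hLF : ∀ v, L (F v) = L v := fun v => by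
    have := LinearMap.congr_fun hs (L.rangeRestrict v)
    exact congrArg Subtype.val this
  have hF : ∀ v a, F v a = ∑ j, F (Pi.single j 1) a * v j := by
    intro v a
    have hv : v = ∑ j, MulOpposite.op (v j) • (Pi.single j 1 : Fin k → R) := by
      ext i
      simp [Finset.sum_apply, Pi.single_apply]
    conv_lhs => rw [hv]
    simp [Finset.sum_apply]
  refine ⟨fun a j => F (Pi.single j 1) a, fun i j => ?_, fun v hv a => ?_⟩
  · have := congrFun (hLF (Pi.single j 1)) i
    simpa [L, Pi.single_apply] using this
  · rw [← hF]
    have h0 : L v = 0 := funext hv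
    have : L.rangeRestrict v = 0 := Subtype.ext h0
    simp [F, this]

/-- Over a right semihereditary ring, low formulas have `s`-torsion witnesses. -/
theorem sat_sSub {R : Type u} [Ring R] (hsh : RightSemihereditary R) (φ : PPFormula R 1)
    (hφ : φ.IsLow) {X : Type u} [AddCommGroup X] [Module R X] (x : sSub R X)
    (hx : φ.Sat X (fun _ => (x : X))) : φ.Sat (sSub R X) (fun _ => x) := by
  obtain ⟨y, hy⟩ := hx
  obtain ⟨G, hG1, hG2⟩ := exists_matrix hsh φ.coeffExist
  have hmem : ∀ a, ∑ j, G a j • y j ∈ sSub R X := by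
    intro a
    have := mem_sSet_of_system (ι := Fin φ.nEq) (κ := Fin 1 ⊕ Fin φ.nExist)
      (fun i => Sum.elim (φ.coeffFree i) (φ.coeffExist i))
      (Sum.elim (fun _ => 0) (fun j => G a j))
      (by
        intro y hy
        simp only [Fintype.sum_sum_type, Sum.elim_inl, Sum.elim_inr] at hy
        have := hφ (y (Sum.inl 0)) ⟨fun j => y (Sum.inr j), fun i => by simpa using hy i⟩
        have := hG2 (fun j => y (Sum.inr j)) (fun i => by simpa [this] using hy i) a
        simpa using this)
      (Sum.elim (fun _ => (x : X)) y)
      (by simpa using hy)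
    change _ ∈ sSet R X
    simpa using this
  refine ⟨fun a => ⟨_, hmem a⟩, fun i => Subtype.ext ?_⟩
  have h := hy i
  have e1 : ∑ a, φ.coeffExist i a • ∑ j, G a j • y j = ∑ j, φ.coeffExist i j • y j := by
    simp only [Finset.smul_sum, smul_smul]
    rw [Finset.sum_comm]
    simp only [← Finset.sum_smul, hG1]
  simpa [e1] using h

/-! ### Direct sums -/

theorem sat_directSum {R : Type u} [Ring R] {n : ℕ} (φ : PPFormula R n) {I X : Type u}
    [AddCommGroup X] [Module R X] (x : Fin n → DirectSum I fun _ => X)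
    (h : ∀ i, φ.Sat X (fun j => x j i)) : φ.Sat (DirectSum I fun _ => X) x := by
  classical
  choose Y hY using h
  let S : Finset I := Finset.univ.biUnion (fun j => DFinsupp.support (x j))
  refine ⟨fun j => DFinsupp.mk S (fun i => Y i j), fun q => ?_⟩
  refine DFinsupp.ext fun i => ?_
  have hq := hY i q
  have key : ∀ j, (DFinsupp.mk S (fun i => Y i j) : DirectSum I fun _ => X) i
      = if i ∈ S then Y i j else 0 := by
    intro j
    exact DFinsupp.mk_apply
  have lin : ∀ {k : ℕ} (c : Fin k → R) (w : Fin k → DirectSum I fun _ => X),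
      (∑ j, c j • w j) i = ∑ j, c j • (w j i) := by
    intro k c w
    have := map_sum (DirectSum.component R I (fun _ => X) i) (fun j => c j • w j) Finset.univ
    exact this
  rw [DirectSum.add_apply, lin, lin]
  by_cases hi : i ∈ S
  · simpa [key, hi] using hq
  · have hx : ∀ j, x j i = 0 := by
      intro j
      by_contra hne
      exact hi (Finset.mem_biUnion.2 ⟨j, Finset.mem_univ _, DFinsupp.mem_support_iff.2 hne⟩)
    simp [key, hi, hx]

theorem sat_component {R : Type u} [Ring R] {n : ℕ} (φ : PPFormula R n) {I X : Type u}
    [AddCommGroup X] [Module R X] (x : Fin n → DirectSum I fun _ => X)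
    (h : φ.Sat (DirectSum I fun _ => X) x) (i : I) : φ.Sat X (fun j => x j i) :=
  sat_map φ (DirectSum.component R I (fun _ => X) i) x h

theorem sTorsion_directSum {R : Type u} [Ring R] {X : Type u} [AddCommGroup X] [Module R X]
    (hX : IsSTorsion R X) (I : Type u) : IsSTorsion R (DirectSum I fun _ => X) := by
  classical
  intro x
  induction x using DirectSum.induction_on with
  | zero => exact sSet_zero
  | of i x => exact sSet_map (DirectSum.lof R I (fun _ => X) i) (hX x)
  | add x y hx hy => exact sSet_add hx hy

/-- A version of the low-pp descending chain condition. -/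
def LowDCC (R : Type u) [Ring R] (X : Type u) [AddCommGroup X] [Module R X] : Prop :=
  ∀ φ : ℕ → PPFormula R 1, (φ 0).IsLow →
    ∃ n, ∀ k, ∀ x : X, (∀ i : Fin (n + 1), (φ i).Sat X (fun _ => x)) → (φ k).Sat X (fun _ => x)

theorem lowDCC_directSum {R : Type u} [Ring R] {X : Type u} [AddCommGroup X] [Module R X]
    (hX : LowDCC R X) (I : Type u) : LowDCC R (DirectSum I fun _ => X) := by
  intro φ h0
  obtain ⟨n, hn⟩ := hX φ h0
  refine ⟨n, fun k x hx => sat_directSum _ _ fun i => hn k _ fun q => ?_⟩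
  exact sat_component _ _ (hx q) i

theorem lowDCC_pure {R : Type u} [Ring R] {X Y : Type u} [AddCommGroup X] [Module R X]
    [AddCommGroup Y] [Module R Y] (e : X →ₗ[R] Y) (he : IsPureEmb e)
    (hY : LowDCC R Y) : LowDCC R X := by
  intro φ h0
  obtain ⟨n, hn⟩ := hY φ h0
  exact ⟨n, fun k x hx => he.2 1 (φ k) _ (hn k (e x) fun q => sat_map _ e _ (hx q))⟩

/-! ### Σ-pure-injective implies the chain condition -/

theorem lowDCC_of_sigma {R : Type u} [Ring R] (hsh : RightSemihereditary R)
    {N : Type u} [AddCommGroup N] [Module R N] (hN : IsSTorsion R N)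
    (h : IsSigmaKsTorPureInjective R N) : LowDCC R N := by
  classical
  intro φ h0
  by_contra hcon
  push Not at hcon
  choose κ a ha hna using hcon
  let I : Type u := ULift.{u} ℕ
  let P := sSub R (I → N)
  let coeLin : (DirectSum I fun _ => N) →ₗ[R] (I → N) :=
    LinearMap.pi (fun i => DirectSum.component R I (fun _ => N) i)
  let g : (DirectSum I fun _ => N) →ₗ[R] P :=
    coeLin.codRestrict P (fun x => sSet_map coeLin (sTorsion_directSum hN I x))
  have hP : IsSTorsion R P := by
    intro x
    obtain ⟨ψ, hψ, hx⟩ := x.2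
    exact ⟨ψ, hψ, sat_sSub hsh ψ hψ x hx⟩
  have hg : IsPureEmb g := by
    constructor
    · intro x y hxy
      refine DFinsupp.ext fun i => ?_
      exact congrFun (congrArg Subtype.val hxy) i
    · intro k ψ x hx
      refine sat_directSum ψ x fun i => ?_
      exact sat_map ψ (LinearMap.proj i ∘ₗ P.subtype) _ hx
  obtain ⟨r, hr⟩ := (h I).2 _ P (h I).1 hP g hg LinearMap.id
  have satPi : ∀ (ψ : PPFormula R 1) (v : I → N), (∀ i, ψ.Sat N (fun _ => v i)) →
      ψ.Sat (I → N) (fun _ => v) := by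
    intro ψ v hv
    choose Y hY using hv
    refine ⟨fun j i => Y i j, fun q => funext fun i => ?_⟩
    simpa using hY i q
  have sat0 : ∀ ψ : PPFormula R 1, ψ.Sat N (fun _ => 0) := fun ψ => ⟨fun _ => 0, by simp⟩
  have ha0 : ∀ n, (φ 0).Sat N (fun _ => a n) := fun n => ha n 0
  let A : I → N := fun i => a i.down
  have hA : A ∈ P := ⟨φ 0, h0, satPi _ _ fun i => ha0 _⟩
  let rA := r ⟨A, hA⟩
  -- all components of the image are nonzero
  have hne : ∀ i : I, rA i ≠ 0 := by
    intro i hi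
    let K := max (κ i.down) (i.down + 1)
    let T : I → N := fun j => if j.down < K then 0 else a j.down
    have hT : ∀ k ≤ K, (φ k).Sat (I → N) (fun _ => T) := by
      intro k hk
      refine satPi _ _ fun j => ?_
      by_cases hj : j.down < K
      · simpa [T, hj] using sat0 (φ k)
      · have := ha j.down ⟨k, by omega⟩
        simpa [T, hj] using this
    have hTP : T ∈ P := ⟨φ 0, h0, hT 0 (Nat.zero_le _)⟩
    have hTs : (φ (κ i.down)).Sat P (fun _ => ⟨T, hTP⟩) := by
      have := sat_sSub hsh (conj (φ 0) (φ (κ i.down))) (low_conj _ _ h0) (X := I → N) ⟨T, hTP⟩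
        ((sat_conj _ _ _).2 ⟨hT 0 (Nat.zero_le _), hT _ (le_max_left _ _)⟩)
      exact ((sat_conj _ _ _).1 this).2
    let H : DirectSum I fun _ => N :=
      DFinsupp.mk ((Finset.range K).image ULift.up) (fun j => a j.1.down)
    have hH : ∀ j : I, H j = if j.down < K then a j.down else 0 := by
      intro j
      have : H j = if hh : j ∈ ((Finset.range K).image ULift.up) then a j.down else 0 :=
        DFinsupp.mk_apply
      rw [this]
      by_cases hj : j.down < K
      · have : j ∈ ((Finset.range K).image ULift.up) :=
          Finset.mem_image.2 ⟨j.down, Finset.mem_range.2 hj, rfl⟩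
        simp [hj, this]
      · have : j ∉ ((Finset.range K).image ULift.up) := by
          intro hm
          obtain ⟨q, hq, rfl⟩ := Finset.mem_image.1 hm
          exact hj (Finset.mem_range.1 hq)
        simp only [hj, this, dif_neg, if_neg, not_false_eq_true]
    have hdec : (⟨A, hA⟩ : P) = g H + ⟨T, hTP⟩ := by
      refine Subtype.ext (funext fun j => ?_)
      change a j.down = H j + T j
      rw [hH]
      by_cases hj : j.down < K <;> simp [T, hj]
    have hrT : rA = H + r ⟨T, hTP⟩ := by
      have := LinearMap.congr_fun hr H
      change r (g H) = H at this
      change r ⟨A, hA⟩ = _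
      rw [hdec, map_add, this]
    have h1 : (φ (κ i.down)).Sat N (fun _ => (r ⟨T, hTP⟩) i) :=
      sat_component _ _ (sat_map _ r _ hTs) i
    have h2 : (r ⟨T, hTP⟩) i = 0 - a i.down := by
      have h3 : rA i = H i + (r ⟨T, hTP⟩) i := by rw [hrT]; rfl
      have h4 : H i = a i.down := by
        rw [hH]; simp [K]
      rw [hi, h4] at h3
      rw [h3]; abel
    have h5 := sat_sub _ (sat0 (φ (κ i.down))) h1
    rw [h2] at h5
    exact hna i.down (by simpa using h5)
  have hfin : (Set.univ : Set I).Finite :=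
    (DFinsupp.support rA).finite_toSet.subset
      (fun i _ => DFinsupp.mem_support_iff.2 (hne i))
  have : Infinite I := inferInstanceAs (Infinite (ULift ℕ))
  exact Set.infinite_univ hfin

/-! ### The chain condition implies pure-injectivity -/

section Split

variable {R : Type u} [Ring R] {M Z : Type u} [AddCommGroup M] [Module R M]
  [AddCommGroup Z] [Module R Z]

/-- Finite systems with parameters in `M` solvable in `(M × Z) / B` are solvable in `M`. -/
def Good (B : Submodule R (M × Z)) : Prop :=
  ∀ (p k : ℕ) (C : Fin p → Fin k → R) (m : Fin p → M),
    (∃ y : Fin k → M × Z, ∀ i, (∑ j, C i j • y j) - (m i, 0) ∈ B) →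
      ∃ y : Fin k → M, ∀ i, ∑ j, C i j • y j = m i

theorem good_chain (c : Set (Submodule R (M × Z))) (hc : ∀ B ∈ c, Good B)
    (hch : IsChain (· ≤ ·) c) (hne : c.Nonempty) : Good (sSup c) := by
  rintro p k C m ⟨y, hy⟩
  have hmem : ∀ i, ∃ B ∈ c, (∑ j, C i j • y j) - (m i, 0) ∈ B := fun i =>
    (Submodule.mem_sSup_of_directed hne hch.directedOn).1 (hy i)
  choose b hb hyb using hmem
  have hub : ∀ s : Finset (Fin p), ∃ B ∈ c, ∀ i ∈ s, b i ≤ B := by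
    classical
    intro s
    induction s using Finset.induction_on with
    | empty => exact ⟨hne.some, hne.some_mem, by simp⟩
    | insert i s _ ih =>
      obtain ⟨B, hB, hs⟩ := ih
      obtain ⟨B', hB', h1, h2⟩ := hch.directedOn B hB (b i) (hb i)
      refine ⟨B', hB', fun j hj => ?_⟩
      rcases Finset.mem_insert.1 hj with rfl | hj
      · exact h2
      · exact (hs j hj).trans h1
  obtain ⟨B, hB, hs⟩ := hub Finset.univ
  exact hc B hB p k C m ⟨y, fun i => hs i (Finset.mem_univ _) (hyb i)⟩

/-- The condition `∃ y, A b + C y = m` modulo `B`. -/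
def InType (B : Submodule R (M × Z)) (b : M × Z) (φ : PPFormula R 1) (m : Fin φ.nEq → M) : Prop :=
  Holds φ b (fun i t => t - (m i, 0) ∈ B)

theorem good_holds {B : Submodule R (M × Z)} (hB : Good B) {b : M × Z} {φ : PPFormula R 1}
    {m : Fin φ.nEq → M} (h : InType B b φ m) : ∃ c : M, Holds φ c (fun i t => t = m i) := by
  obtain ⟨y, hy⟩ := h
  obtain ⟨z, hz⟩ := hB φ.nEq (φ.nExist + 1) (fun i => Fin.cons (φ.coeffFree i 0) (φ.coeffExist i))
    m ⟨Fin.cons b y, fun i => by simpa [Fin.sum_univ_succ] using hy i⟩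
  exact ⟨z 0, fun j => z j.succ, fun i => by simpa [Fin.sum_univ_succ] using hz i⟩

theorem inType_conj {B : Submodule R (M × Z)} {b : M × Z} {φ ψ : PPFormula R 1}
    {m : Fin φ.nEq → M} {l : Fin ψ.nEq → M} (h : InType B b φ m) (h' : InType B b ψ l) :
    InType B b (conj φ ψ) (fun i : Fin (φ.nEq + ψ.nEq) => Fin.addCases m l i) := by
  refine (holds_conj φ ψ b _).2 ⟨?_, ?_⟩
  · simpa only [Fin.addCases_left] using show Holds φ b (fun i t => t - (m i, 0) ∈ B) from h
  · simpa only [Fin.addCases_right] using show Holds ψ b (fun i t => t - (l i, 0) ∈ B) from h'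

theorem holds_diff {φ : PPFormula R 1} {m : Fin φ.nEq → M} {c d : M}
    (hc : Holds φ c (fun i t => t = m i)) (hd : Holds φ d (fun i t => t = m i)) :
    φ.Sat M (fun _ => c - d) := by
  rw [sat_iff_holds]
  obtain ⟨u, hu⟩ := hc
  obtain ⟨v, hv⟩ := hd
  refine ⟨fun j => u j - v j, fun i => ?_⟩
  have h1 := hu i
  have h2 := hv i
  simp only [smul_sub, Finset.sum_sub_distrib]
  rw [sub_add_sub_comm, h1, h2, sub_self]

theorem holds_shift {φ : PPFormula R 1} {m : Fin φ.nEq → M} {c d : M}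
    (hc : φ.Sat M (fun _ => c)) (hd : Holds φ d (fun i t => t = m i)) :
    Holds φ (c + d) (fun i t => t = m i) := by
  rw [sat_iff_holds] at hc
  obtain ⟨u, hu⟩ := hc
  obtain ⟨v, hv⟩ := hd
  refine ⟨fun j => u j + v j, fun i => ?_⟩
  have h1 := hu i
  have h2 := hv i
  simp only [smul_add, Finset.sum_add_distrib]
  rw [add_add_add_comm, h1, h2, zero_add]

theorem exists_realization (hdcc : LowDCC R M) {B : Submodule R (M × Z)} (hB : Good B)
    (b : M × Z) (φ₀ : PPFormula R 1) (m₀ : Fin φ₀.nEq → M) (hlow : φ₀.IsLow)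
    (h₀ : InType B b φ₀ m₀) :
    ∃ c : M, ∀ (φ : PPFormula R 1) (m : Fin φ.nEq → M), InType B b φ m →
      Holds φ c (fun i t => t = m i) := by
  have hmin : ∃ (φ : PPFormula R 1) (m : Fin φ.nEq → M), InType B b φ m ∧
      ∀ (ψ : PPFormula R 1) (l : Fin ψ.nEq → M), InType B b ψ l →
        ∀ x : M, φ.Sat M (fun _ => x) → ψ.Sat M (fun _ => x) := by
    by_contra hcon
    push Not at hcon
    choose ψ l hψ x hx hx' using hcon
    let S := {q : (φ : PPFormula R 1) × (Fin φ.nEq → M) // InType B b q.1 q.2}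
    let step : S → S := fun q =>
      ⟨⟨conj q.1.1 (ψ q.1.1 q.1.2 q.2), fun i : Fin (_ + _) => Fin.addCases q.1.2 (l q.1.1 q.1.2 q.2) i⟩,
        inType_conj q.2 (hψ _ _ _)⟩
    let s : ℕ → S := fun n => Nat.rec ⟨⟨φ₀, m₀⟩, h₀⟩ (fun _ q => step q) n
    have hs : ∀ n, s (n + 1) = step (s n) := fun n => rfl
    obtain ⟨n, hn⟩ := hdcc (fun n => (s n).1.1) hlow
    have hdesc : ∀ n k, k ≤ n → ∀ x : M, (s n).1.1.Sat M (fun _ => x) →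
        (s k).1.1.Sat M (fun _ => x) := by
      intro n k hk
      induction n, hk using Nat.le_induction with
      | base => exact fun _ h => h
      | succ n _ ih =>
        intro x hx
        exact ih x ((sat_conj _ _ x).1 hx).1
    have := hn (n + 1) (x _ _ (s n).2) (fun i => hdesc n i (by omega) _ (hx _ _ (s n).2))
    exact hx' _ _ (s n).2 ((sat_conj _ _ _).1 this).2
  obtain ⟨φ, m, hφ, hmin⟩ := hmin
  obtain ⟨c, hc⟩ := good_holds hB hφ
  refine ⟨c, fun ψ l hψ => ?_⟩
  obtain ⟨d, hd⟩ := good_holds hB (inType_conj hφ hψ)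
  obtain ⟨hd1, hd2⟩ := (holds_conj φ ψ d _).1 hd
  simp only [Fin.addCases_left, Fin.addCases_right] at hd1 hd2
  have h1 := hmin ψ l hψ _ (holds_diff hc hd1)
  simpa using holds_shift h1 hd2

theorem good_extend {B : Submodule R (M × Z)} {b : M × Z} {c : M}
    (h : ∀ (φ : PPFormula R 1) (m : Fin φ.nEq → M), InType B b φ m →
      Holds φ c (fun i t => t = m i)) :
    Good (B ⊔ Submodule.span R {b - (c, 0)}) := by
  rintro p k C m ⟨y, hy⟩
  have : ∀ i, ∃ r : R, (∑ j, C i j • y j) - (m i, 0) - r • (b - (c, 0)) ∈ B := by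
    intro i
    obtain ⟨β, hβ, w, hw, e⟩ := Submodule.mem_sup.1 (hy i)
    obtain ⟨r, rfl⟩ := Submodule.mem_span_singleton.1 hw
    exact ⟨r, by rw [← e]; simpa using hβ⟩
  choose r hr using this
  obtain ⟨z, hz⟩ := h ⟨k, p, fun i _ => - r i, C⟩ (fun i => m i - r i • c) ⟨y, fun i => by
    convert hr i using 1
    have : ((m i - r i • c, 0) : M × Z) = (m i, 0) - r i • (c, 0) := by
      ext <;> simp
    rw [this, smul_sub, neg_smul]
    abel⟩
  refine ⟨z, fun i => ?_⟩
  have h1 := hz i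
  simp only [neg_smul] at h1
  rw [neg_add_eq_iff_eq_add] at h1
  rw [h1]; abel

end Split

theorem pureInj_of_lowDCC {R : Type u} [Ring R] {M : Type u} [AddCommGroup M] [Module R M]
    (hM : IsSTorsion R M) (hdcc : LowDCC R M) : IsKsTorPureInjective R M := by
  refine ⟨hM, ?_⟩
  intro N₁ N₂ _ _ _ _ _ hN₂ g hg f
  let B₀ : Submodule R (M × N₂) := LinearMap.range ((-f).prod g)
  have hB₀ : Good B₀ := by
    rintro p k C m ⟨y, hy⟩
    choose n hn using hy
    have h1 : ∀ i, -f (n i) = (∑ j, C i j • (y j).1) - m i := fun i => by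
      simpa [Prod.fst_sum] using congrArg Prod.fst (hn i)
    have h2 : ∀ i, g (n i) = ∑ j, C i j • (y j).2 := fun i => by
      simpa [Prod.snd_sum] using congrArg Prod.snd (hn i)
    obtain ⟨z, hz⟩ := hg.2 p ⟨k, p, fun i j => if i = j then -1 else 0, C⟩ n
      ⟨fun j => (y j).2, fun i => by simp [ite_smul, h2]⟩
    change Fin k → N₁ at z
    have hz' : ∀ i, ∑ j, C i j • z j = n i := fun i => by
      have := hz i
      simp [ite_smul] at this
      rwa [neg_add_eq_zero, eq_comm] at this
    refine ⟨fun j => (y j).1 + f (z j), fun i => ?_⟩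
    have h3 := congrArg f (hz' i)
    simp only [map_sum, map_smul] at h3
    simp only [smul_add, Finset.sum_add_distrib]
    rw [h3, ← sub_eq_zero]
    have h4 := h1 i
    rw [← sub_eq_zero] at h4
    rw [← neg_eq_zero, ← h4]
    abel
  obtain ⟨B, hB₀B, hBmax⟩ := zorn_le_nonempty₀ {B : Submodule R (M × N₂) | Good B}
    (fun c hc hch y hy => ⟨sSup c, good_chain c hc hch ⟨y, hy⟩, fun z hz => le_sSup hz⟩) B₀ hB₀
  have hB : Good B := hBmax.1
  have hex : ∀ z : N₂, ∃ c : M, ((-c, z) : M × N₂) ∈ B := by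
    intro z
    obtain ⟨φ, hφ, y, hy⟩ := hN₂ z
    obtain ⟨c, hc⟩ := exists_realization hdcc hB (0, z) φ (fun _ => 0) hφ
      ⟨fun j => (0, y j), fun i => by
        have := hy i
        simp only [Finset.univ_unique, Fin.default_eq_zero, Fin.isValue, Finset.sum_singleton] at this
        convert B.zero_mem
        ext
        · simp [Prod.fst_sum]
        · simpa [Prod.snd_sum] using this⟩
    have hle := hBmax.2 (good_extend hc) le_sup_left
    have := hle (Submodule.mem_sup_right (Submodule.mem_span_singleton_self _))
    exact ⟨c, by simpa using this⟩
  have huniq : ∀ c : M, ((c, 0) : M × N₂) ∈ B → c = 0 := by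
    intro c hc
    obtain ⟨y, hy⟩ := hB 1 0 (fun _ _ => 0) (fun _ => c) ⟨fun _ => 0, fun _ => by
      simpa using B.neg_mem hc⟩
    simpa using (hy 0).symm
  choose h hh using hex
  have huniq' : ∀ (z : N₂) (c : M), ((-c, z) : M × N₂) ∈ B → h z = c := by
    intro z c hc
    have := huniq (h z - c) (by
      have := B.sub_mem hc (hh z)
      have e : ((-c, z) - (-h z, z) : M × N₂) = (h z - c, 0) := by
        ext
        · simp; abel
        · simp
      rwa [e] at this)
    exact sub_eq_zero.1 this
  refine ⟨{ toFun := h, map_add' := fun x y => ?_, map_smul' := fun r x => ?_ }, ?_⟩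
  · apply huniq'
    have := B.add_mem (hh x) (hh y)
    convert this using 1
    ext
    · simp; abel
    · simp
  · apply huniq'
    have := B.smul_mem r (hh x)
    convert this using 1
    ext <;> simp
  · ext n
    apply huniq'
    exact hB₀B ⟨n, rfl⟩

theorem sigma_of_lowDCC {R : Type u} [Ring R] {M : Type u} [AddCommGroup M] [Module R M]
    (hM : IsSTorsion R M) (hdcc : LowDCC R M) : IsSigmaKsTorPureInjective R M := fun I =>
  pureInj_of_lowDCC (sTorsion_directSum hM I) (lowDCC_directSum hdcc I)

/-! ### Elementary equivalence -/

open FirstOrder Language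

theorem exists_term {R : Type u} [Ring R] {α : Type} (n : ℕ) (c : Fin n → R) (v : Fin n → α) :
    ∃ T : (moduleLang R).Term α, ∀ (X : Type u) [AddCommGroup X] [Module R X] (x : α → X),
      T.realize x = ∑ j, c j • x (v j) := by
  induction n with
  | zero =>
    refine ⟨Term.func (l := 0) (show (moduleLang R).Functions 0 from PUnit.unit) Fin.elim0, ?_⟩
    intro X _ _ x
    simp only [Finset.univ_eq_empty, Finset.sum_empty]
    rfl
  | succ n ih =>
    obtain ⟨T, hT⟩ := ih (fun j => c j.succ) (fun j => v j.succ)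
    let S : (moduleLang R).Term α :=
      Term.func (l := 1) (show (moduleLang R).Functions 1 from c 0) (fun _ => Term.var (v 0))
    refine ⟨Term.func (l := 2) (show (moduleLang R).Functions 2 from PUnit.unit) ![S, T], ?_⟩
    intro X _ _ x
    rw [Fin.sum_univ_succ, ← hT X x]
    rfl

theorem exists_formula {R : Type u} [Ring R] (φ : PPFormula R 1) :
    ∃ F : (moduleLang R).Formula (Empty ⊕ Fin 1),
      ∀ (X : Type u) [AddCommGroup X] [Module R X] (x : Empty ⊕ Fin 1 → X),
        F.Realize x ↔ φ.Sat X (fun _ => x (Sum.inr 0)) := by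
  have hT : ∀ i : Fin φ.nEq, ∃ T : (moduleLang R).Term ((Empty ⊕ Fin 1) ⊕ Fin φ.nExist),
      ∀ (X : Type u) [AddCommGroup X] [Module R X] (x : (Empty ⊕ Fin 1) ⊕ Fin φ.nExist → X),
      T.realize x = φ.coeffFree i 0 • x (Sum.inl (Sum.inr 0)) +
        ∑ j, φ.coeffExist i j • x (Sum.inr j) := by
    intro i
    obtain ⟨T, hT⟩ := exists_term (φ.nExist + 1) (Fin.cons (φ.coeffFree i 0) (φ.coeffExist i))
      (Fin.cons (Sum.inl (Sum.inr 0)) Sum.inr : Fin _ → (Empty ⊕ Fin 1) ⊕ Fin φ.nExist)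
    refine ⟨T, fun X _ _ x => ?_⟩
    rw [hT]
    simp [Fin.sum_univ_succ]
  choose T hT using hT
  obtain ⟨O, hO⟩ := exists_term (R := R) (α := (Empty ⊕ Fin 1) ⊕ Fin φ.nExist) 0
    Fin.elim0 Fin.elim0
  refine ⟨Formula.iExs (Fin φ.nExist) (Formula.iInf fun i => (T i).equal O), ?_⟩
  intro X _ _ x
  simp [Formula.realize_iExs, Formula.realize_iInf, Formula.realize_equal, hT, hO, PPFormula.Sat]

theorem lowDCC_elem {R : Type u} [Ring R] {M N : Type u} [AddCommGroup M] [Module R M]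
    [AddCommGroup N] [Module R N] (h : (moduleLang R).ElementarilyEquivalent M N)
    (hN : LowDCC R N) : LowDCC R M := by
  intro φ h0
  obtain ⟨n, hn⟩ := hN φ h0
  refine ⟨n, fun k => ?_⟩
  choose F hF using fun i => exists_formula (φ i)
  let σ : (moduleLang R).Sentence :=
    Formula.iAlls (Fin 1) ((Formula.iInf fun i : Fin (n + 1) => F i).imp (F k))
  have hσ : ∀ (X : Type u) [AddCommGroup X] [Module R X], X ⊨ σ ↔
      ∀ x : X, (∀ i : Fin (n + 1), (φ i).Sat X (fun _ => x)) → (φ k).Sat X (fun _ => x) := by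
    intro X _ _
    simp only [σ, Sentence.Realize, Formula.realize_iAlls, Formula.realize_imp,
      Formula.realize_iInf, hF, Sum.elim_inr]
    exact ⟨fun h x => h (fun _ => x), fun h x => h (x 0)⟩
  rw [← hσ M]
  exact (elementarilyEquivalent_iff.1 h σ).2 ((hσ N).2 (hn k))

end KsTor

/-- **Corollary.** Assume `R` is right semihereditary and `M`, `N` are `𝔰`-torsion
modules.  Then:
(a) if `N` is `Σ`-`K^{𝔰-Tor}`-pure-injective, then `N` is `K^{𝔰-Tor}`-pure-injective;
(b) if `M ≤_p N` and `N` is `Σ`-`K^{𝔰-Tor}`-pure-injective, then so is `M`;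
(c) if `M` is elementarily equivalent to `N` (in the first-order language of
`R`-modules) and `N` is `Σ`-`K^{𝔰-Tor}`-pure-injective, then so is `M`. -/
theorem sigmaKsTorPureInjective_closure (R : Type u) [Ring R]
    (hsh : RightSemihereditary R)
    (M N : Type u) [AddCommGroup M] [Module R M] [AddCommGroup N] [Module R N]
    (hM : IsSTorsion R M) (hN : IsSTorsion R N) :
    (IsSigmaKsTorPureInjective R N → IsKsTorPureInjective R N) ∧
    (∀ e : M →ₗ[R] N, IsPureEmb e →
      IsSigmaKsTorPureInjective R N → IsSigmaKsTorPureInjective R M) ∧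
    ((moduleLang R).ElementarilyEquivalent M N →
      IsSigmaKsTorPureInjective R N → IsSigmaKsTorPureInjective R M) := by
  have key : IsSigmaKsTorPureInjective R N → KsTor.LowDCC R N := KsTor.lowDCC_of_sigma hsh hN
  refine ⟨fun h => KsTor.pureInj_of_lowDCC hN (key h), fun e he h => ?_, fun heq h => ?_⟩
  · exact KsTor.sigma_of_lowDCC hM (KsTor.lowDCC_pure e he (key h))
  · exact KsTor.sigma_of_lowDCC hM (KsTor.lowDCC_elem heq (key h))
end

section
/- Let R be a Prüfer domain and let M be a torsion R-module. Then M is K^{s-Tor}-pure-injective if and only if M is torsion-ultracomplete. -/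
/- Core notions: pp-formulas, low formulas, s-torsion modules, pure embeddings. -/

universe u

open Cardinal

/-- A module over a commutative domain is torsion if every element is annihilated by a
nonzero ring element. -/
def IsTorsionModule (R : Type u) [CommRing R] (M : Type u)
    [AddCommGroup M] [Module R M] : Prop :=
  ∀ m : M, ∃ r : R, r ≠ 0 ∧ r • m = 0

/-- `M` is `K^{𝔰-Tor}`-pure-injective (for a commutative domain, where the `𝔰`-torsion
modules are exactly the torsion modules): every homomorphism from a torsion module to
`M` extends along pure embeddings between torsion modules. -/
def IsKTorPureInjective (R : Type u) [CommRing R] (M : Type u)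
    [AddCommGroup M] [Module R M] : Prop :=
  ∀ (N₁ N₂ : Type u) [AddCommGroup N₁] [Module R N₁] [AddCommGroup N₂] [Module R N₂],
    IsTorsionModule R N₁ → IsTorsionModule R N₂ →
      ∀ (g : N₁ →ₗ[R] N₂), IsPureEmb g →
        ∀ f : N₁ →ₗ[R] M, ∃ h : N₂ →ₗ[R] M, h.comp g = f

/-- `M` is torsion-ultracomplete: whenever `M ≤_p N` and `N/M` is torsion, `M` is a
direct summand of `N`. -/
def TorsionUltracomplete (R : Type u) [CommRing R] (M : Type u)
    [AddCommGroup M] [Module R M] : Prop :=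
  ∀ (N : Type u) [AddCommGroup N] [Module R N] (e : M →ₗ[R] N), IsPureEmb e →
    IsTorsionModule R (N ⧸ LinearMap.range e) →
      ∃ g : N →ₗ[R] M, g.comp e = LinearMap.id

/-- A commutative ring is semihereditary if every finitely generated submodule of a
projective module is projective; a Prüfer domain is a commutative domain which is
semihereditary. -/
def IsSemihereditaryCommRing (R : Type u) [CommRing R] : Prop :=
  ∀ (P : Type u) [AddCommGroup P] [Module R P], Module.Projective R P →
    ∀ N : Submodule R P, N.FG → Module.Projective R ↥N


/-- The pushout of a pure embedding is a pure embedding. -/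
theorem pushout_pure {R : Type u} [CommRing R] {N₁ N₂ M : Type u} [AddCommGroup N₁] [Module R N₁]
    [AddCommGroup N₂] [Module R N₂] [AddCommGroup M] [Module R M]
    (g : N₁ →ₗ[R] N₂) (hg : IsPureEmb g) (f : N₁ →ₗ[R] M) :
    IsPureEmb ((LinearMap.range (f.prod (-g))).mkQ.comp (LinearMap.inl R M N₂)) := by
  constructor
  · rw [← LinearMap.ker_eq_bot, LinearMap.ker_eq_bot']
    intro m hm
    rw [LinearMap.comp_apply, Submodule.mkQ_apply, Submodule.Quotient.mk_eq_zero] at hm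
    obtain ⟨z, hz⟩ := hm
    have h1 : f z = m := congrArg Prod.fst hz
    have h2 : -g z = 0 := congrArg Prod.snd hz
    have h3 : z = 0 := hg.1 (by rw [map_zero]; exact neg_eq_zero.mp h2)
    rw [← h1, h3, map_zero]
  · rintro k φ x ⟨y, hy⟩
    choose p hp using fun j => Submodule.mkQ_surjective (LinearMap.range (f.prod (-g))) (y j)
    have key : ∀ i, ∃ z, (f.prod (-g)) z =
        (∑ j, φ.coeffFree i j • (LinearMap.inl R M N₂ (x j))) + ∑ j, φ.coeffExist i j • p j := by
      intro i
      rw [← LinearMap.mem_range, ← Submodule.Quotient.mk_eq_zero, ← Submodule.mkQ_apply]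
      rw [← hy i]
      simp only [map_add, map_sum, map_smul, hp, Function.comp_apply, LinearMap.comp_apply]
    choose z hz using key
    have hz1 : ∀ i, f (z i) = (∑ j, φ.coeffFree i j • x j) + ∑ j, φ.coeffExist i j • (p j).1 := by
      intro i
      have := congrArg (LinearMap.fst R M N₂) (hz i)
      simpa only [map_add, map_sum, map_smul, LinearMap.fst_apply, LinearMap.inl_apply,
        LinearMap.prod_apply, Function.prod] using this
    have hz2 : ∀ i, -g (z i) = ∑ j, φ.coeffExist i j • (p j).2 := by
      intro i
      have := congrArg (LinearMap.snd R M N₂) (hz i)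
      simpa only [map_add, map_sum, map_smul, LinearMap.snd_apply, LinearMap.inl_apply,
        LinearMap.prod_apply, Function.prod, smul_zero, Finset.sum_const_zero, zero_add,
        LinearMap.neg_apply] using this
    obtain ⟨w, hw⟩ := hg.2 φ.nEq ⟨φ.nExist, φ.nEq, fun i j => if i = j then 1 else 0,
      φ.coeffExist⟩ z ⟨fun j => (p j).2, fun i => by
        simp [← hz2]⟩
    refine ⟨fun j => (p j).1 + f (w j), fun i => ?_⟩
    have h := congrArg f (hw i)
    simp only [ite_smul, one_smul, zero_smul, Finset.sum_ite_eq, Finset.mem_univ, if_true,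
      map_add, map_sum, map_smul, map_zero] at h
    rw [hz1] at h
    simp only [smul_add, Finset.sum_add_distrib]
    rw [← add_assoc]
    exact h

/-- **Lemma.** Let `R` be a Prüfer domain (a commutative domain which is
semihereditary) and `M` a torsion `R`-module.  Then `M` is `K^{𝔰-Tor}`-pure-injective
if and only if `M` is torsion-ultracomplete. -/
theorem kTorPureInjective_iff_torsionUltracomplete
    (R : Type u) [CommRing R] [IsDomain R] (hPrufer : IsSemihereditaryCommRing R)
    (M : Type u) [AddCommGroup M] [Module R M] (hM : IsTorsionModule R M) :
    IsKTorPureInjective R M ↔ TorsionUltracomplete R M := by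
  constructor
  · intro H N _ _ e he ht
    refine H M N hM (fun n => ?_) e he LinearMap.id
    obtain ⟨r, hr, hrn⟩ := ht (Submodule.Quotient.mk n)
    rw [← Submodule.Quotient.mk_smul, Submodule.Quotient.mk_eq_zero] at hrn
    obtain ⟨m, hm⟩ := hrn
    obtain ⟨s, hs, hsm⟩ := hM m
    exact ⟨s * r, mul_ne_zero hs hr, by rw [mul_smul, ← hm, ← map_smul, hsm, map_zero]⟩
  · intro H N₁ N₂ _ _ _ _ h1 h2 g hg f
    obtain ⟨q, hq⟩ := H _ _ (pushout_pure g hg f) (by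
      intro x
      obtain ⟨x, rfl⟩ := Submodule.Quotient.mk_surjective _ x
      obtain ⟨⟨m, n⟩, rfl⟩ := Submodule.Quotient.mk_surjective _ x
      obtain ⟨r, hr, hrn⟩ := h2 n
      refine ⟨r, hr, ?_⟩
      rw [← Submodule.Quotient.mk_smul, Submodule.Quotient.mk_eq_zero,
        ← Submodule.Quotient.mk_smul]
      exact ⟨r • m, by rw [Prod.smul_mk, hrn]; rfl⟩)
    refine ⟨q.comp ((LinearMap.range (f.prod (-g))).mkQ.comp (LinearMap.inr R M N₂)), ?_⟩
    ext z
    have h3 := LinearMap.congr_fun hq (f z)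
    rw [LinearMap.id_apply] at h3
    rw [← h3]
    simp only [LinearMap.comp_apply]
    congr 1
    symm
    rw [← sub_eq_zero, ← map_sub, Submodule.mkQ_apply, Submodule.Quotient.mk_eq_zero]
    exact ⟨z, by simp⟩
end

section
/- Let R be a ring. If N₁ and N₂ are s-torsion left R-modules and N₁ ≤_p N and N₂ ≤_p N for some left R-module N, then L = N₁ + N₂ (the submodule of N generated by N₁ and N₂) is an s-torsion module with N₁ ≤_p L, N₂ ≤_p L and L ⊆ N. Consequently, the class of s-torsion modules with pure embeddings is nicely generated in the class of all left R-modules with pure embeddings. -/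
/- Core notions: pp-formulas, low formulas, s-torsion modules, pure embeddings. -/

universe u

open Cardinal

/-- The class of `𝔰`-torsion modules with pure embeddings is nicely generated in the
class of all left `R`-modules with pure embeddings: any two `𝔰`-torsion pure
submodules of a module `N` are pure submodules of a common `𝔰`-torsion submodule
of `N`. -/
def NicelyGenerated (R : Type u) [Ring R] : Prop :=
  ∀ (N : Type u) [AddCommGroup N] [Module R N] (P₁ P₂ : Submodule R N),
    IsSTorsion R ↥P₁ → IsSTorsion R ↥P₂ →
      IsPureEmb P₁.subtype → IsPureEmb P₂.subtype →
        ∃ (L : Submodule R N) (h₁ : P₁ ≤ L) (h₂ : P₂ ≤ L),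
          IsSTorsion R ↥L ∧ IsPureEmb (Submodule.inclusion h₁) ∧
            IsPureEmb (Submodule.inclusion h₂)

theorem exists_ppFormula_of_fintype {R : Type u} [Ring R] {α β : Type} [Fintype α] [Fintype β]
    (c : α → R) (d : α → β → R) :
    ∃ φ : PPFormula R 1, ∀ (M : Type u) [AddCommGroup M] [Module R M] (x : M),
      φ.Sat M (fun _ => x) ↔ ∃ y : β → M, ∀ i, c i • x + ∑ j, d i j • y j = 0 := by
  let e := Fintype.equivFin α
  let f := Fintype.equivFin β
  refine ⟨⟨Fintype.card β, Fintype.card α, fun i _ => c (e.symm i),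
    fun i j => d (e.symm i) (f.symm j)⟩, fun M _ _ x => ?_⟩
  constructor
  · rintro ⟨y, hy⟩
    refine ⟨fun j => y (f j), fun i => ?_⟩
    have h := hy (e i)
    simp only [Finset.univ_unique, Finset.sum_singleton, Equiv.symm_apply_apply] at h
    rw [← h]
    congr 1
    exact Fintype.sum_equiv f _ _ (by simp)
  · rintro ⟨y, hy⟩
    refine ⟨fun j => y (f.symm j), fun i => ?_⟩
    have h := hy (e.symm i)
    simp only [Finset.univ_unique, Finset.sum_singleton]
    rw [← h]
    congr 1
    exact Fintype.sum_equiv f.symm _ _ (by simp)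

/-- Sum of two pp-formulas. -/
theorem exists_ppFormula_add {R : Type u} [Ring R] (φ ψ : PPFormula R 1) :
    ∃ θ : PPFormula R 1, ∀ (M : Type u) [AddCommGroup M] [Module R M] (x : M),
      θ.Sat M (fun _ => x) ↔
        ∃ a b : M, φ.Sat M (fun _ => a) ∧ ψ.Sat M (fun _ => b) ∧ x = a + b := by
  obtain ⟨θ, hθ⟩ := exists_ppFormula_of_fintype (R := R)
    (α := Fin φ.nEq ⊕ Fin ψ.nEq) (β := Unit ⊕ (Fin φ.nExist ⊕ Fin ψ.nExist))
    (Sum.elim (fun _ => 0) (fun i => ψ.coeffFree i 0))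
    (Sum.elim
      (fun i => Sum.elim (fun _ => φ.coeffFree i 0) (Sum.elim (φ.coeffExist i) fun _ => 0))
      (fun i => Sum.elim (fun _ => - ψ.coeffFree i 0) (Sum.elim (fun _ => 0) (ψ.coeffExist i))))
  refine ⟨θ, fun M _ _ x => (hθ M x).trans ?_⟩
  constructor
  · rintro ⟨y, hy⟩
    refine ⟨y (.inl ()), x - y (.inl ()), ⟨fun j => y (.inr (.inl j)), fun i => ?_⟩,
      ⟨fun j => y (.inr (.inr j)), fun i => ?_⟩, by abel⟩
    · simpa using hy (.inl i)
    · have := hy (.inr i)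
      simp only [Sum.elim_inr, Fintype.sum_sum_type, Sum.elim_inl, Finset.univ_unique,
        Finset.sum_singleton, zero_smul, Finset.sum_const_zero, zero_add, neg_smul] at this
      simp only [Finset.univ_unique, Finset.sum_singleton, smul_sub]
      rw [← this]
      simp only [Fin.default_eq_zero]
      change _ = _ + (-(ψ.coeffFree i 0 • y (.inl ())) + _)
      abel
  · rintro ⟨a, b, ⟨y, hy⟩, ⟨z, hz⟩, rfl⟩
    refine ⟨Sum.elim (fun _ => a) (Sum.elim y z), ?_⟩
    rintro (i | i)
    · simpa using hy i
    · have := hz i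
      simp only [Finset.univ_unique, Finset.sum_singleton, Fin.default_eq_zero] at this
      simp only [Sum.elim_inr, Fintype.sum_sum_type, Sum.elim_inl, Finset.univ_unique,
        Finset.sum_singleton, zero_smul, Finset.sum_const_zero, zero_add, neg_smul, smul_add]
      rw [← this]
      abel

theorem PPFormula.Sat.map {R : Type u} [Ring R] {n : ℕ} {φ : PPFormula R n}
    {M N : Type u} [AddCommGroup M] [Module R M] [AddCommGroup N] [Module R N]
    (f : M →ₗ[R] N) {x : Fin n → M} (h : φ.Sat M x) : φ.Sat N (⇑f ∘ x) := by
  obtain ⟨y, hy⟩ := h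
  refine ⟨⇑f ∘ y, fun i => ?_⟩
  have := congrArg f (hy i)
  simpa [map_add, map_sum] using this

theorem isPureEmb_inclusion {R : Type u} [Ring R] {N : Type u} [AddCommGroup N] [Module R N]
    {P L : Submodule R N} (h : P ≤ L) (hP : IsPureEmb P.subtype) :
    IsPureEmb (Submodule.inclusion h) :=
  ⟨Submodule.inclusion_injective h, fun k φ x hx => hP.2 k φ x (hx.map L.subtype)⟩

theorem isSTorsion_sup {R : Type u} [Ring R] {N : Type u} [AddCommGroup N] [Module R N]
    (P₁ P₂ : Submodule R N) (h₁ : IsSTorsion R ↥P₁) (h₂ : IsSTorsion R ↥P₂) :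
    IsSTorsion R ↥(P₁ ⊔ P₂) := by
  rintro ⟨m, hm⟩
  obtain ⟨a, ha, b, hb, rfl⟩ := Submodule.mem_sup.1 hm
  obtain ⟨φ, hφ, sφ⟩ := h₁ ⟨a, ha⟩
  obtain ⟨ψ, hψ, sψ⟩ := h₂ ⟨b, hb⟩
  obtain ⟨θ, hθ⟩ := exists_ppFormula_add φ ψ
  refine ⟨θ, fun r hr => ?_, (hθ _ _).2 ⟨_, _,
    sφ.map (Submodule.inclusion (le_sup_left : P₁ ≤ P₁ ⊔ P₂)),
    sψ.map (Submodule.inclusion (le_sup_right : P₂ ≤ P₁ ⊔ P₂)), rfl⟩⟩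
  obtain ⟨s, t, hs, ht, rfl⟩ := (hθ R r).1 hr
  rw [hφ s hs, hψ t ht, add_zero]

/-- **Lemma.** If `N₁`, `N₂` are `𝔰`-torsion pure submodules of a module `N`, then
`L = N₁ + N₂` is an `𝔰`-torsion submodule of `N` containing `N₁` and `N₂` as pure
submodules.  Consequently, the class of `𝔰`-torsion modules with pure embeddings is
nicely generated in `(R`-Mod`, ≤_p)`. -/
theorem sTorsion_nicelyGenerated (R : Type u) [Ring R] :
    (∀ (N : Type u) [AddCommGroup N] [Module R N] (P₁ P₂ : Submodule R N),
      IsSTorsion R ↥P₁ → IsSTorsion R ↥P₂ →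
        IsPureEmb P₁.subtype → IsPureEmb P₂.subtype →
          IsSTorsion R ↥(P₁ ⊔ P₂) ∧
            IsPureEmb (Submodule.inclusion (le_sup_left : P₁ ≤ P₁ ⊔ P₂)) ∧
            IsPureEmb (Submodule.inclusion (le_sup_right : P₂ ≤ P₁ ⊔ P₂))) ∧
    NicelyGenerated R := by
  have key : ∀ (N : Type u) [AddCommGroup N] [Module R N] (P₁ P₂ : Submodule R N),
      IsSTorsion R ↥P₁ → IsSTorsion R ↥P₂ →
        IsPureEmb P₁.subtype → IsPureEmb P₂.subtype →
          IsSTorsion R ↥(P₁ ⊔ P₂) ∧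
            IsPureEmb (Submodule.inclusion (le_sup_left : P₁ ≤ P₁ ⊔ P₂)) ∧
            IsPureEmb (Submodule.inclusion (le_sup_right : P₂ ≤ P₁ ⊔ P₂)) :=
    fun N _ _ P₁ P₂ h₁ h₂ p₁ p₂ =>
      ⟨isSTorsion_sup P₁ P₂ h₁ h₂, isPureEmb_inclusion _ p₁, isPureEmb_inclusion _ p₂⟩
  exact ⟨key, fun N _ _ P₁ P₂ h₁ h₂ p₁ p₂ =>
    ⟨P₁ ⊔ P₂, le_sup_left, le_sup_right, key N P₁ P₂ h₁ h₂ p₁ p₂⟩⟩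
end

section
/- Let R be any ring and M, N left R-modules. If there exist a pure embedding f: M → N and a pure embedding g: N → M, then the pure-injective envelopes PE(M) and PE(N) are isomorphic. -/
/- Core notions: pp-formulas, low formulas, s-torsion modules, pure embeddings. -/

universe u

open Cardinal

/- Pure-injective modules and pure-injective envelopes. -/

/-- A module `M` is pure-injective if every homomorphism into `M` extends along
arbitrary pure embeddings. -/
def IsPureInjective (R : Type u) [Ring R] (M : Type u)
    [AddCommGroup M] [Module R M] : Prop :=
  ∀ (N₁ N₂ : Type u) [AddCommGroup N₁] [Module R N₁] [AddCommGroup N₂] [Module R N₂]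
    (g : N₁ →ₗ[R] N₂), IsPureEmb g →
      ∀ f : N₁ →ₗ[R] M, ∃ h : N₂ →ₗ[R] M, h.comp g = f

/-- `(E, e)` is a pure-injective envelope of `M`: `E` is pure-injective, `e : M → E`
is a pure embedding, and `E` is minimal with these properties, i.e. any pure embedding
of `M` into a pure-injective module extends to a pure embedding of `E`. -/
def IsPureInjEnvelope (R : Type u) [Ring R] (M E : Type u)
    [AddCommGroup M] [Module R M] [AddCommGroup E] [Module R E]
    (e : M →ₗ[R] E) : Prop :=
  IsPureInjective R E ∧ IsPureEmb e ∧
    ∀ (N : Type u) [AddCommGroup N] [Module R N], IsPureInjective R N →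
      ∀ f : M →ₗ[R] N, IsPureEmb f →
        ∃ g : E →ₗ[R] N, IsPureEmb g ∧ g.comp e = f


/-! ### Minimal idempotents in compact right topological monoids -/

theorem exists_min_idem (S : Type*) [Monoid S] [TopologicalSpace S] [CompactSpace S] [T2Space S]
    (hc : ∀ r : S, Continuous (fun s => s * r)) :
    ∃ e : S, e * e = e ∧ ∀ s : S, ∃ t : S, t * (s * e) = e := by
  let Z : Set (Set S) := {L | IsClosed L ∧ L.Nonempty ∧ ∀ s : S, ∀ l ∈ L, s * l ∈ L}
  have hz : ∃ m, m ⊆ Set.univ ∧ Minimal (fun x => x ∈ Z) m := by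
    apply zorn_superset_nonempty Z
    · intro c hcZ hchain hne
      refine ⟨⋂₀ c, ⟨isClosed_sInter fun t ht => (hcZ ht).1, ?_, ?_⟩,
        fun s hs => Set.sInter_subset_of_mem hs⟩
      · have : Nonempty c := hne.to_subtype
        rw [Set.sInter_eq_iInter]
        refine IsCompact.nonempty_iInter_of_directed_nonempty_isCompact_isClosed _ ?_ ?_ ?_ ?_
        · intro a b
          rcases hchain.total a.2 b.2 with h | h
          · exact ⟨a, subset_rfl, h⟩
          · exact ⟨b, h, subset_rfl⟩
        · exact fun i => (hcZ i.2).2.1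
        · exact fun i => (hcZ i.2).1.isCompact
        · exact fun i => (hcZ i.2).1
      · intro s l hl t ht
        exact (hcZ ht).2.2 s l (hl t ht)
    · exact ⟨isClosed_univ, ⟨1, trivial⟩, fun _ _ _ => trivial⟩
  obtain ⟨L, -, hL⟩ := hz
  obtain ⟨hLc, hLn, hLi⟩ := hL.1
  obtain ⟨e, heL, he⟩ := exists_idempotent_in_compact_subsemigroup hc L hLn hLc.isCompact
    (fun x _ y hy => hLi x y hy)
  refine ⟨e, he, fun s => ?_⟩
  have hmem : Set.range (fun t => t * (s * e)) ∈ Z := by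
    refine ⟨(isCompact_range (hc _)).isClosed, ⟨_, ⟨1, rfl⟩⟩, ?_⟩
    rintro a _ ⟨t, rfl⟩
    exact ⟨a * t, by simp [mul_assoc]⟩
  have hsub : Set.range (fun t => t * (s * e)) ⊆ L := by
    rintro _ ⟨t, rfl⟩
    exact hLi _ _ (hLi _ _ heL)
  exact hL.2 hmem hsub heL

/-! ### The double dual -/

/-- the circle as an additive group -/
abbrev TT : Type := AddCircle (1 : ℝ)

theorem exists_char {G : Type*} [AddCommGroup G] (x : G) (hx : x ≠ 0) :
    ∃ χ : G →+ TT, χ x ≠ 0 := by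
  obtain ⟨c, hc⟩ := CharacterModule.exists_character_apply_ne_zero_of_ne_zero hx
  let j : AddCircle (1 : ℚ) →+ TT :=
    QuotientAddGroup.map _ _ (Rat.castHom ℝ).toAddMonoidHom (by
      intro q hq
      obtain ⟨n, rfl⟩ := AddSubgroup.mem_zmultiples_iff.1 hq
      exact AddSubgroup.mem_zmultiples_iff.2 ⟨n, by simp⟩)
  have hj : Function.Injective j := by
    rw [injective_iff_map_eq_zero]
    intro a
    induction a using QuotientAddGroup.induction_on with
    | H q =>
      intro h
      have h' : ((q : ℝ) : AddCircle (1 : ℝ)) = 0 := h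
      obtain ⟨n, hn⟩ := (AddCircle.coe_eq_zero_iff _).1 h'
      refine (AddCircle.coe_eq_zero_iff _).2 ⟨n, ?_⟩
      simp only [zsmul_eq_mul, mul_one] at hn ⊢
      exact_mod_cast hn
  refine ⟨j.comp c, fun h => hc (hj ?_)⟩
  rw [map_zero]
  exact h

theorem exists_char_sub {G : Type*} [AddCommGroup G] (H : AddSubgroup G) (x : G) (hx : x ∉ H) :
    ∃ χ : G →+ TT, (∀ h ∈ H, χ h = 0) ∧ χ x ≠ 0 := by
  obtain ⟨c, hc⟩ := exists_char (QuotientAddGroup.mk' H x)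
    (by simpa [QuotientAddGroup.eq_zero_iff] using hx)
  refine ⟨c.comp (QuotientAddGroup.mk' H), fun h hh => ?_, hc⟩
  have : QuotientAddGroup.mk' H h = 0 := (QuotientAddGroup.eq_zero_iff h).2 hh
  rw [AddMonoidHom.comp_apply, this, map_zero]

/-- The double dual of an abelian group. -/
def BiDual (A : Type u) [AddCommGroup A] : Type u := (A →+ TT) →+ TT

namespace BiDual

variable {R : Type u} [Ring R] {A : Type u} [AddCommGroup A] [Module R A]

noncomputable instance : AddCommGroup (BiDual A) :=
  inferInstanceAs (AddCommGroup ((A →+ TT) →+ TT))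

/-- evaluation -/
def ap (k : BiDual A) (c : A →+ TT) : TT := (show (A →+ TT) →+ TT from k) c

/-- precomposition of a character by a scalar -/
def tw (c : A →+ TT) (r : R) : A →+ TT := c.comp (DistribSMul.toAddMonoidHom A r)

theorem tw_apply (c : A →+ TT) (r : R) (a : A) : tw c r a = c (r • a) := rfl

theorem ap_add_right (k : BiDual A) (c d : A →+ TT) : ap k (c + d) = ap k c + ap k d :=
  AddMonoidHom.map_add k c d

theorem ap_add (k l : BiDual A) (c : A →+ TT) : ap (k + l) c = ap k c + ap l c := rfl

theorem ap_zero (c : A →+ TT) : ap (0 : BiDual A) c = 0 := rfl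

theorem ext' {k l : BiDual A} (h : ∀ c, ap k c = ap l c) : k = l :=
  AddMonoidHom.ext (f := (k : (A →+ TT) →+ TT)) (g := l) h

/-- constructor -/
def mk (F : (A →+ TT) → TT) (h : ∀ c d, F (c + d) = F c + F d) : BiDual A :=
  AddMonoidHom.mk' F h

theorem ap_mk (F : (A →+ TT) → TT) (h : ∀ c d, F (c + d) = F c + F d) (c : A →+ TT) :
    ap (mk F h) c = F c := rfl

noncomputable instance : SMul R (BiDual A) :=
  ⟨fun r k => mk (fun c => ap k (tw c r)) (fun c d => ap_add_right k (tw c r) (tw d r))⟩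

theorem ap_smul (r : R) (k : BiDual A) (c : A →+ TT) : ap (r • k) c = ap k (tw c r) := rfl

noncomputable instance : Module R (BiDual A) where
  one_smul k := ext' fun c => by
    rw [ap_smul]; congr 1; ext a; simp [tw_apply]
  mul_smul r s k := ext' fun c => by
    rw [ap_smul, ap_smul, ap_smul]; congr 1; ext a; simp [tw_apply, mul_smul]
  smul_zero r := ext' fun c => rfl
  smul_add r k l := ext' fun c => rfl
  add_smul r s k := ext' fun c => by
    rw [ap_smul, ap_add, ap_smul, ap_smul, ← ap_add_right]
    congr 1; ext a; simp [tw_apply, add_smul]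
  zero_smul k := ext' fun c => by
    rw [ap_smul, ap_zero]
    have : tw c (0 : R) = 0 := by ext a; simp [tw_apply]
    rw [this]
    exact AddMonoidHom.map_zero (k : (A →+ TT) →+ TT)

variable (R A) in
/-- canonical map to the double dual -/
noncomputable def ev : A →ₗ[R] BiDual A where
  toFun a := mk (fun c => c a) (fun _ _ => rfl)
  map_add' a b := ext' fun c => by simp [ap_mk, ap_add]
  map_smul' r a := ext' fun c => by simp [ap_mk, ap_smul, tw_apply]

theorem ap_ev (a : A) (c : A →+ TT) : ap (ev R A a) c = c a := rfl

/-- evaluation at a character as a homomorphism -/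
noncomputable def apL (c : A →+ TT) : BiDual A →+ TT := AddMonoidHom.mk' (fun k => ap k c) (fun _ _ => rfl)

/-- a bidual element as a homomorphism -/
noncomputable def apR (k : BiDual A) : (A →+ TT) →+ TT := k

variable (R A) in
theorem isPureEmb_ev : IsPureEmb (ev R A) := by
  constructor
  · rw [injective_iff_map_eq_zero]
    intro a ha
    by_contra hne
    obtain ⟨c, hc⟩ := exists_char a hne
    apply hc
    rw [← ap_ev (R := R), ha]; rfl
  · rintro k φ x ⟨y, hy⟩
    let D : (Fin φ.nExist → A) →+ (Fin φ.nEq → A) :=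
      AddMonoidHom.mk' (fun z i => ∑ j, φ.coeffExist i j • z j) (by
        intro a b; ext i; simp [Finset.sum_add_distrib])
    let v : Fin φ.nEq → A := fun i => ∑ j, φ.coeffFree i j • x j
    by_cases hv : -v ∈ D.range
    · obtain ⟨z, hz⟩ := hv
      refine ⟨z, fun i => ?_⟩
      have := congrFun hz i
      change ∑ j, φ.coeffExist i j • z j = - v i at this
      rw [this]; exact add_neg_cancel _
    · exfalso
      obtain ⟨χ, hχ, hχv⟩ := exists_char_sub D.range _ hv
      apply hχv
      let c : Fin φ.nEq → (A →+ TT) := fun i => χ.comp (AddMonoidHom.single (fun _ => A) i)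
      have hdec : ∀ w, χ w = ∑ i, c i (w i) := by
        intro w
        conv_lhs => rw [← Finset.univ_sum_single w]
        rw [map_sum]; rfl
      have hcz : ∀ j, ∑ i, tw (c i) (φ.coeffExist i j) = 0 := by
        intro j
        ext a
        have h1 := hχ (D (Pi.single j a)) ⟨_, rfl⟩
        rw [hdec] at h1
        rw [AddMonoidHom.finsetSum_apply, AddMonoidHom.zero_apply, ← h1]
        refine Finset.sum_congr rfl fun i _ => ?_
        rw [tw_apply]
        congr 1
        change _ = ∑ j', φ.coeffExist i j' • (Pi.single j a : Fin φ.nExist → A) j'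
        rw [Finset.sum_eq_single j]
        · simp
        · intro b _ hb; simp [hb]
        · simp
      have h2 : ∑ i, apL (c i) ((∑ j, φ.coeffFree i j • (ev R A ∘ x) j)
          + (∑ j, φ.coeffExist i j • y j)) = 0 := by
        refine Finset.sum_eq_zero fun i _ => ?_
        rw [hy i, map_zero]
      simp only [map_add, Finset.sum_add_distrib] at h2
      have h3 : ∑ i, apL (c i) (∑ j, φ.coeffExist i j • y j) = 0 := by
        simp only [map_sum]
        rw [Finset.sum_comm]
        refine Finset.sum_eq_zero fun j _ => ?_
        have : ∀ i, apL (c i) (φ.coeffExist i j • y j)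
            = apR (y j) (tw (c i) (φ.coeffExist i j)) := fun i => rfl
        simp only [this]
        rw [← map_sum, hcz, map_zero]
      have h4 : ∑ i, apL (c i) (∑ j, φ.coeffFree i j • (ev R A ∘ x) j) = χ v := by
        rw [hdec]
        refine Finset.sum_congr rfl fun i _ => ?_
        have : ∑ j, φ.coeffFree i j • (ev R A ∘ x) j = ev R A (v i) := by
          simp [v, map_sum]
        rw [this]; rfl
      rw [h3, h4, add_zero] at h2
      rw [map_neg, h2, neg_zero]

/-- The minimal idempotent among endomorphisms of the double dual fixing a set. -/
theorem exists_min (X : Set (BiDual A)) :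
    ∃ e : Module.End R (BiDual A), e * e = e ∧ (∀ x ∈ X, e x = x) ∧
      ∀ s : Module.End R (BiDual A), (∀ x ∈ X, s x = x) →
        ∃ t : Module.End R (BiDual A), (∀ x ∈ X, t x = x) ∧ t * (s * e) = e := by
  let S : Submonoid (Module.End R (BiDual A)) :=
    { carrier := {s | ∀ x ∈ X, s x = x}
      one_mem' := fun x _ => rfl
      mul_mem' := fun {a b} ha hb x hx => by
        rw [Module.End.mul_apply, hb x hx, ha x hx] }
  let F : S → (BiDual A → (A →+ TT) → TT) := fun s k c => ap (s.1 k) c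
  let : TopologicalSpace S := TopologicalSpace.induced F inferInstance
  have hFi : Topology.IsInducing F := ⟨rfl⟩
  have hFinj : Function.Injective F := by
    intro s t h
    apply Subtype.ext
    apply LinearMap.ext
    intro k
    exact ext' fun c => congrFun (congrFun h k) c
  have hcont : ∀ k c, Continuous (fun G : BiDual A → (A →+ TT) → TT => G k c) :=
    fun k c => (continuous_apply c).comp (continuous_apply k)
  have hrange : IsClosed (Set.range F) := by
    have : Set.range F =
        {G | ∀ k c d, G k (c + d) = G k c + G k d} ∩ {G | ∀ k l c, G (k + l) c = G k c + G l c}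
        ∩ {G | ∀ (r : R) k c, G (r • k) c = G k (tw c r)} ∩ {G | ∀ x ∈ X, ∀ c, G x c = ap x c} := by
      ext G
      constructor
      · rintro ⟨s, rfl⟩
        refine ⟨⟨⟨fun k c d => ap_add_right _ _ _, fun k l c => ?_⟩, fun r k c => ?_⟩,
          fun x hx c => ?_⟩
        · change ap (s.1 (k + l)) c = _
          rw [map_add]; rfl
        · change ap (s.1 (r • k)) c = _
          rw [map_smul]; rfl
        · change ap (s.1 x) c = _
          rw [s.2 x hx]
      · rintro ⟨⟨⟨h1, h2⟩, h3⟩, h4⟩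
        refine ⟨⟨{ toFun := fun k => mk (G k) (h1 k)
                   map_add' := fun k l => ext' fun c => h2 k l c
                   map_smul' := fun r k => ext' fun c => h3 r k c },
          fun x hx => ext' fun c => h4 x hx c⟩, rfl⟩
    rw [this]
    refine ((IsClosed.inter ?_ ?_).inter ?_).inter ?_
    · simp only [Set.ofPred_forall]
      exact isClosed_iInter fun k => isClosed_iInter fun c => isClosed_iInter fun d =>
        isClosed_eq (hcont _ _) ((hcont _ _).add (hcont _ _))
    · simp only [Set.ofPred_forall]
      exact isClosed_iInter fun k => isClosed_iInter fun c => isClosed_iInter fun d =>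
        isClosed_eq (hcont _ _) ((hcont _ _).add (hcont _ _))
    · simp only [Set.ofPred_forall]
      exact isClosed_iInter fun k => isClosed_iInter fun c => isClosed_iInter fun d =>
        isClosed_eq (hcont _ _) (hcont _ _)
    · simp only [Set.ofPred_forall]
      exact isClosed_iInter fun k => isClosed_iInter fun c => isClosed_iInter fun d =>
        isClosed_eq (hcont _ _) continuous_const
  have hemb : Topology.IsClosedEmbedding F := ⟨⟨hFi, hFinj⟩, hrange⟩
  have : Fact ((0 : ℝ) < 1) := ⟨one_pos⟩
  have : CompactSpace S := hemb.compactSpace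
  have : T2Space S := hemb.isEmbedding.t2Space
  obtain ⟨e, he, hmin⟩ := exists_min_idem S (fun r => by
    rw [hFi.continuous_iff]
    refine continuous_pi fun k => continuous_pi fun c => ?_
    exact (hcont (r.1 k) c).comp hFi.continuous)
  refine ⟨e.1, congrArg Subtype.val he, e.2, fun s hs => ?_⟩
  obtain ⟨t, ht⟩ := hmin ⟨s, hs⟩
  exact ⟨t.1, t.2, congrArg Subtype.val ht⟩

end BiDual

/-- Minimal idempotents over a subset of a pure-injective module. -/
theorem exists_min_pureInj {R : Type u} [Ring R] {A : Type u} [AddCommGroup A] [Module R A]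
    (hA : IsPureInjective R A) (X : Set A) :
    ∃ e : Module.End R A, e * e = e ∧ (∀ x ∈ X, e x = x) ∧
      ∀ s : Module.End R A, (∀ x ∈ X, s x = x) →
        ∃ t : Module.End R A, (∀ x ∈ X, t x = x) ∧ t * s * e = e := by
  obtain ⟨p, hp⟩ := hA _ _ (BiDual.ev R A) (BiDual.isPureEmb_ev R A) LinearMap.id
  set i := BiDual.ev R A with hi
  have hpi : ∀ a, p (i a) = a := fun a => LinearMap.congr_fun hp a
  obtain ⟨e, he, heX, hmin⟩ := BiDual.exists_min (R := R) (i '' X)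
  have heX' : ∀ x ∈ X, e (i x) = i x := fun x hx => heX _ ⟨x, hx, rfl⟩
  have hee : ∀ k, e (e k) = e k := fun k => LinearMap.congr_fun he k
  obtain ⟨θ, hθX, hθ⟩ := hmin (i ∘ₗ p) (by
    rintro _ ⟨x, hx, rfl⟩
    simp [hpi])
  have hθ' : ∀ k, θ (i (p (e k))) = e k := fun k => LinearMap.congr_fun hθ k
  have hθX' : ∀ x ∈ X, θ (i x) = i x := fun x hx => hθX _ ⟨x, hx, rfl⟩
  refine ⟨p ∘ₗ e ∘ₗ θ ∘ₗ i, ?_, ?_, ?_⟩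
  · ext a
    simp [Module.End.mul_apply, hθ', hee]
  · intro x hx
    simp [hθX' x hx, heX' x hx, hpi]
  · intro s hs
    obtain ⟨t, htX, ht⟩ := hmin (i ∘ₗ s ∘ₗ p) (by
      rintro _ ⟨x, hx, rfl⟩
      simp [hpi, hs x hx])
    have ht' : ∀ k, t (i (s (p (e k)))) = e k := fun k => LinearMap.congr_fun ht k
    refine ⟨p ∘ₗ t ∘ₗ i, fun x hx => ?_, ?_⟩
    · simp [htX _ ⟨x, hx, rfl⟩, hpi]
    · ext a
      simp [Module.End.mul_apply, ht']

/-- Bumby's theorem for pure-injective modules, with split embeddings. -/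
theorem bumby {R : Type u} [Ring R] {A B : Type u} [AddCommGroup A] [Module R A]
    [AddCommGroup B] [Module R B] (hA : IsPureInjective R A)
    (f : A →ₗ[R] B) (f' : B →ₗ[R] A) (hf : ∀ a, f' (f a) = a)
    (g : B →ₗ[R] A) (g' : A →ₗ[R] B) (hg : ∀ b, g' (g b) = b) :
    Nonempty (A ≃ₗ[R] B) := by
  let φ : Module.End R A := g ∘ₗ f
  let ρ : Module.End R A := f' ∘ₗ g'
  let q : Module.End R A := g ∘ₗ g'
  have hρφ : ∀ a, ρ (φ a) = a := fun a => by simp [ρ, φ, hg, hf]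
  have hqφ : ∀ a, q (φ a) = φ a := fun a => by simp [q, φ, hg]
  have hqq : ∀ a, q (q a) = q a := fun a => by simp [q, hg]
  let C : Submodule R A := LinearMap.ker g'
  have hqC : ∀ c ∈ C, q c = 0 := fun c hc => by
    have : g' c = 0 := hc
    simp [q, this]
  have hsubC : ∀ a, a - q a ∈ C := fun a => by simp [C, q, hg]
  let X : Submodule R A := ⨆ n : ℕ, C.map (φ ^ n)
  have hCX : ∀ c ∈ C, c ∈ X := fun c hc =>
    Submodule.mem_iSup_of_mem 0 ⟨c, hc, by simp⟩
  have hX : ∀ x ∈ X, φ x ∈ X ∧ ∃ c ∈ C, ∃ x' ∈ X, x = c + φ x' := by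
    intro x hx
    refine Submodule.iSup_induction (fun n : ℕ => C.map (φ ^ n))
      (motive := fun x => φ x ∈ X ∧ ∃ c ∈ C, ∃ x' ∈ X, x = c + φ x') hx ?_ ?_ ?_
    · rintro n _ ⟨c, hc, rfl⟩
      refine ⟨Submodule.mem_iSup_of_mem (n + 1) ⟨c, hc, by rw [pow_succ']; rfl⟩, ?_⟩
      cases n with
      | zero => exact ⟨c, hc, 0, X.zero_mem, by simp⟩
      | succ n =>
        exact ⟨0, C.zero_mem, (φ ^ n) c, Submodule.mem_iSup_of_mem n ⟨c, hc, rfl⟩, by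
          rw [pow_succ', zero_add]; rfl⟩
    · exact ⟨by simp, 0, C.zero_mem, 0, X.zero_mem, by simp⟩
    · rintro x y ⟨hx, c, hc, x', hx', h1⟩ ⟨hy, d, hd, y', hy', h2⟩
      refine ⟨by rw [map_add]; exact X.add_mem hx hy, c + d, C.add_mem hc hd, x' + y',
        X.add_mem hx' hy', ?_⟩
      rw [map_add, h1, h2]; abel
  obtain ⟨e, he0, heX, hmin⟩ := exists_min_pureInj hA (X : Set A)
  have he : ∀ a, e (e a) = e a := fun a => LinearMap.congr_fun he0 a
  let e1 : Module.End R A := φ * e * ρ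
  have he1 : ∀ a, e1 a = φ (e (ρ a)) := fun a => rfl
  let e2 : Module.End R A := 1 - q + e1 * q
  have he2 : ∀ a, e2 a = a - q a + φ (e (ρ (q a))) := fun a => rfl
  have he22 : ∀ a, e2 (e2 a) = e2 a := by
    intro a
    simp only [he2, map_add, map_sub, hqφ, hqq, hρφ, he]
    abel
  have he2X : ∀ x ∈ X, e2 x = x := by
    intro x hx
    obtain ⟨c, hc, x', hx', rfl⟩ := (hX x hx).2
    rw [he2, map_add, hqC c hc, hqφ, zero_add, hρφ, heX x' hx']
    abel
  have hmin2 : ∀ s : Module.End R A, (∀ x ∈ X, s x = x) →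
      ∃ t : Module.End R A, ∀ a, t (s (e2 a)) = e2 a := by
    intro s hs
    obtain ⟨η, hηX, hη0⟩ := hmin (ρ * q * s * φ) (by
      intro x hx
      simp only [Module.End.mul_apply]
      rw [hs _ (hX x hx).1, hqφ, hρφ])
    have hη : ∀ a, η (ρ (q (s (φ (e a))))) = e a := fun a => LinearMap.congr_fun hη0 a
    let t : Module.End R A := φ * e * η * ρ * q
    have ht : ∀ a, t a = φ (e (η (ρ (q a)))) := fun a => rfl
    refine ⟨t + (1 - q) - (1 - q) * s * t, fun a => ?_⟩
    have h1 : s (e2 a) = (a - q a) + s (φ (e (ρ (q a)))) := by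
      rw [he2, map_add, hs _ (hCX _ (hsubC a))]
    have h2 : t (s (e2 a)) = φ (e (ρ (q a))) := by
      rw [h1, map_add, ht, ht, hη, he, hqC _ (hsubC a)]
      simp
    change t (s (e2 a)) + (s (e2 a) - q (s (e2 a))) - (s (t (s (e2 a))) - q (s (t (s (e2 a)))))
      = e2 a
    rw [h2, h1, he2, map_add, hqC _ (hsubC a)]
    abel
  obtain ⟨θ1, hθ1X, hθ10⟩ := hmin e2 he2X
  have hθ1 : ∀ a, θ1 (e2 (e a)) = e a := fun a => LinearMap.congr_fun hθ10 a
  obtain ⟨θ2, hθ2⟩ := hmin2 (e * θ1) (by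
    intro x hx
    rw [Module.End.mul_apply, hθ1X x hx, heX x hx])
  have hθ2' : ∀ a, θ2 (e (θ1 (e2 a))) = e2 a := hθ2
  -- `w = e θ1 e2` and `u = e2 e` are mutually inverse
  have hwu : ∀ a, e (θ1 (e2 (e2 (e a)))) = e a := fun a => by rw [he22, hθ1, he]
  have huw : ∀ a, e2 (e (e (θ1 (e2 a)))) = e2 a := fun a => by
    have key : ∀ b, e2 (e b) = e2 (θ2 (e b)) := fun b => by
      have := hθ2' (e2 (e b))
      rw [he22, hθ1, he] at this
      rw [this, he22]
    rw [he, key, hθ2', he22]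
  let W : Module.End R A := φ * e * θ1 * e2
  have hW : ∀ a, W a = φ (e (θ1 (e2 a))) := fun a => rfl
  let U : Module.End R A := e2 * e * ρ
  have hU : ∀ a, U a = e2 (e (ρ a)) := fun a => rfl
  let δ : Module.End R A := q - e1 * q
  have hδ : ∀ a, δ a = q a - φ (e (ρ (q a))) := fun a => rfl
  have hδ2 : ∀ a, δ a = a - e2 a := fun a => by rw [hδ, he2]; abel
  have he2δ : ∀ a, e2 (δ a) = 0 := fun a => by rw [hδ2, map_sub, he22, sub_self]
  have hδe2 : ∀ a, δ (e2 a) = 0 := fun a => by rw [hδ2, he22, sub_self]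
  have hqδ : ∀ a, q (δ a) = δ a := fun a => by simp only [hδ, map_sub, hqq, hqφ]
  have hεδ : ∀ a, e1 (δ a) = 0 := fun a => by
    rw [he1, hδ, map_sub, map_sub, hρφ, he, sub_self, map_zero]
  have hqW : ∀ a, q (W a) = W a := fun a => hqφ _
  have he1W : ∀ a, e1 (W a) = W a := fun a => by rw [he1, hW, hρφ, he]
  have hδδ : ∀ a, δ (δ a) = δ a := fun a => by rw [hδ2 (δ a), he2δ, sub_zero]
  have hδW : ∀ a, δ (W a) = 0 := fun a => by
    change q (W a) - e1 (q (W a)) = 0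
    rw [hqW, he1W, sub_self]
  have hUW : ∀ a, U (W a) = e2 a := fun a => by
    rw [hU, hW, hρφ, huw]
  have hWU : ∀ a, W (U a) = e1 a := fun a => by
    rw [hU, hW, hwu, he1]
  have hWδ : ∀ a, W (δ a) = 0 := fun a => by rw [hW, he2δ]; simp
  have hδU : ∀ a, δ (U a) = 0 := fun a => hδe2 _
  let α : A →ₗ[R] B := g' ∘ₗ (W + δ)
  let β : B →ₗ[R] A := (U * e1 + δ) ∘ₗ g
  refine ⟨LinearEquiv.ofLinearMap α β ?_ ?_⟩
  · ext b
    change g' (W (U (e1 (g b)) + δ (g b)) + δ (U (e1 (g b)) + δ (g b))) = b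
    rw [map_add W, map_add δ, hWU, hWδ, hδU, hδδ, add_zero, zero_add]
    have h1 : e1 (e1 (g b)) = e1 (g b) := by simp only [he1, hρφ, he]
    have h2 : q (g b) = g b := by simp [q, hg]
    have h3 : δ (g b) = g b - e1 (g b) := by
      change q (g b) - e1 (q (g b)) = _
      rw [h2]
    rw [h1, h3, add_sub_cancel, hg]
  · ext a
    change U (e1 (q (W a + δ a))) + δ (q (W a + δ a)) = a
    rw [map_add, hqW, hqδ, map_add, he1W, hεδ, add_zero, hUW, map_add, hδW, hδδ, zero_add, hδ2,
      add_sub_cancel]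

theorem IsPureEmb.comp' {R : Type u} [Ring R] {A B C : Type u} [AddCommGroup A] [Module R A]
    [AddCommGroup B] [Module R B] [AddCommGroup C] [Module R C] {g : B →ₗ[R] C} {f : A →ₗ[R] B}
    (hg : IsPureEmb g) (hf : IsPureEmb f) : IsPureEmb (g ∘ₗ f) := by
  refine ⟨hg.1.comp hf.1, fun k φ x h => hf.2 k φ x (hg.2 k φ _ ?_)⟩
  exact h

/-- **Lemma.** Let `M`, `N` be any two modules.  If there are pure embeddings
`f : M → N` and `g : N → M`, then the pure-injective envelopes `PE(M)` and `PE(N)`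
are isomorphic. -/
theorem pureInjEnvelope_iso_of_mutual_pureEmb (R : Type u) [Ring R]
    (M N : Type u) [AddCommGroup M] [Module R M] [AddCommGroup N] [Module R N]
    (f : M →ₗ[R] N) (hf : IsPureEmb f) (g : N →ₗ[R] M) (hg : IsPureEmb g)
    (EM EN : Type u) [AddCommGroup EM] [Module R EM] [AddCommGroup EN] [Module R EN]
    (eM : M →ₗ[R] EM) (eN : N →ₗ[R] EN)
    (hEM : IsPureInjEnvelope R M EM eM) (hEN : IsPureInjEnvelope R N EN eN) :
    Nonempty (EM ≃ₗ[R] EN) := by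
  obtain ⟨F, hF, -⟩ := hEM.2.2 EN hEN.1 (eN ∘ₗ f) (hEN.2.1.comp' hf)
  obtain ⟨G, hG, -⟩ := hEN.2.2 EM hEM.1 (eM ∘ₗ g) (hEM.2.1.comp' hg)
  obtain ⟨F', hF'⟩ := hEM.1 _ _ F hF LinearMap.id
  obtain ⟨G', hG'⟩ := hEN.1 _ _ G hG LinearMap.id
  exact bumby hEM.1 F F' (fun a => LinearMap.congr_fun hF' a) G G'
    (fun b => LinearMap.congr_fun hG' b)
end
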